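/- arXiv:1907.02837 — 2 statements merged into one kernel-verified Lean document; each statement's English description precedes it below -/
import Mathlib

section
/- Let s, p be uniformly continuous on ℝ^N×ℝ^N satisfying (S1) and (P1), and let γ ∈ C₊(ℝ^N) be uniformly continuous with γ(x) ≥ p(x,x) for all x ∈ ℝ^N and inf_{x∈ℝ^N}(p_s*(x) − γ(x)) > 0. Then W^{s(x,y),p(x,x),p(x,y)}(ℝ^N) is continuously embedded into L^{γ(x)}(ℝ^N): there exists K > 0 such that ‖u‖_{L^{γ(x)}(ℝ^N)} ≤ K‖u‖_W for all u ∈ W^{s(x,y),p(x,x),p(x,y)}(ℝ^N). -/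
open MeasureTheory Set Filter ENNReal

noncomputable section

namespace VarOrderChoquard

variable {N : ℕ}

/-- `ℝ^N` with the Euclidean structure. -/
abbrev RN (N : ℕ) := EuclideanSpace ℝ (Fin N)

/-- `Φ⁻` : infimum of a two-variable real function over `ℝ^N × ℝ^N`. -/
def inf2 (f : RN N → RN N → ℝ) : ℝ := sInf {t | ∃ x y, f x y = t}

/-- `Φ⁺` : supremum of a two-variable real function over `ℝ^N × ℝ^N`. -/
def sup2 (f : RN N → RN N → ℝ) : ℝ := sSup {t | ∃ x y, f x y = t}

/-- `Φ⁻` over a subset `D ⊆ ℝ^N`. -/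
def infOn (D : Set (RN N)) (g : RN N → ℝ) : ℝ := sInf (g '' D)

/-- `Φ⁺` over a subset `D ⊆ ℝ^N`. -/
def supOn (D : Set (RN N)) (g : RN N → ℝ) : ℝ := sSup (g '' D)

/-- `C₊(ℝ^N × ℝ^N)` : continuous with `1 < Φ⁻ ≤ Φ⁺ < ∞`. -/
def CPlus2 (f : RN N → RN N → ℝ) : Prop :=
  Continuous (fun z : RN N × RN N => f z.1 z.2) ∧ 1 < inf2 f ∧
    BddAbove {t | ∃ x y, f x y = t}

/-- `C₊(D)` for `D ⊆ ℝ^N`. -/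
def CPlusOn (D : Set (RN N)) (g : RN N → ℝ) : Prop :=
  ContinuousOn g D ∧ 1 < infOn D g ∧ BddAbove (g '' D)

/-- Condition (S1). -/
def S1 (s : RN N → RN N → ℝ) : Prop :=
  Continuous (fun z : RN N × RN N => s z.1 z.2) ∧ (∀ x y, s x y = s y x) ∧
    BddAbove {t | ∃ x y, s x y = t} ∧ 0 < inf2 s ∧ sup2 s < 1

/-- Condition (P1). -/
def P1 (s p : RN N → RN N → ℝ) : Prop :=
  CPlus2 p ∧ (∀ x y, p x y = p y x) ∧ sup2 s * sup2 p < N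

/-- Condition (μ1). -/
def Mu1 (μ : RN N → RN N → ℝ) : Prop :=
  (∀ x y, μ x y = μ y x) ∧ BddAbove {t | ∃ x y, μ x y = t} ∧
    0 < inf2 μ ∧ sup2 μ < N

/-- The critical exponent `p_s*(x) = N p(x,x) / (N - s(x,x) p(x,x))`. -/
def pstar (s p : RN N → RN N → ℝ) (x : RN N) : ℝ :=
  N * p x x / (N - s x x * p x x)

/-- The class `𝓜` : `p(x,x) ≤ r(x)q⁻ ≤ r(x)q⁺ < p_s*(x)` for all `x`. -/
def MemM (s p q : RN N → RN N → ℝ) (r : RN N → ℝ) : Prop :=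
  ∀ x, p x x ≤ r x * inf2 q ∧ r x * inf2 q ≤ r x * sup2 q ∧
    r x * sup2 q < pstar s p x

/-- Variable-exponent modular `∫_U |u/l|^{γ(x)} dx`. -/
def lmodular (U : Set (RN N)) (γ : RN N → ℝ) (u : RN N → ℝ) (l : ℝ) : ℝ≥0∞ :=
  ∫⁻ x in U, ENNReal.ofReal (|u x| / l) ^ γ x

/-- Membership in the variable-exponent Lebesgue space `L^{γ(x)}(U)`. -/
def MemVarLp (U : Set (RN N)) (γ : RN N → ℝ) (u : RN N → ℝ) : Prop :=
  Measurable u ∧ ∃ l, 0 < l ∧ lmodular U γ u l < ⊤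

/-- Luxemburg norm on `L^{γ(x)}(U)`. -/
def luxNorm (U : Set (RN N)) (γ : RN N → ℝ) (u : RN N → ℝ) : ℝ :=
  sInf {l | 0 < l ∧ lmodular U γ u l ≤ 1}

/-- Membership in the classical Lebesgue space `L^t(U)` (constant exponent `t`). -/
def MemCLp (U : Set (RN N)) (t : ℝ) (g : RN N → ℝ) : Prop :=
  Measurable g ∧ (∫⁻ x in U, ENNReal.ofReal |g x| ^ t) < ⊤

/-- The classical `L^t(U)`-norm. -/
def cLpNorm (U : Set (RN N)) (t : ℝ) (g : RN N → ℝ) : ℝ :=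
  (∫⁻ x in U, ENNReal.ofReal |g x| ^ t).toReal ^ (1 / t)

/-- Gagliardo-type modular
`∫_A (|u(x)-u(y)|/l)^{p(x,y)} / |x-y|^{N+s(x,y)p(x,y)} dx dy`. -/
def gmodular (A : Set (RN N × RN N)) (s p : RN N → RN N → ℝ) (u : RN N → ℝ)
    (l : ℝ) : ℝ≥0∞ :=
  ∫⁻ z in A, ENNReal.ofReal (|u z.1 - u z.2| / l) ^ p z.1 z.2 /
    ENNReal.ofReal (dist z.1 z.2) ^ ((N : ℝ) + s z.1 z.2 * p z.1 z.2)

/-- Membership in `W^{s(x,y),β(x),p(x,y)}(U)`. -/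
def MemW (U : Set (RN N)) (s p : RN N → RN N → ℝ) (β : RN N → ℝ)
    (u : RN N → ℝ) : Prop :=
  MemVarLp U β u ∧ ∃ l, 0 < l ∧ gmodular (U ×ˢ U) s p u l < ⊤

/-- The Gagliardo seminorm `[u]_U^{s,p}`. -/
def wSeminorm (U : Set (RN N)) (s p : RN N → RN N → ℝ) (u : RN N → ℝ) : ℝ :=
  sInf {l | 0 < l ∧ gmodular (U ×ˢ U) s p u l < 1}

/-- The norm on `W`. -/
def wNorm (U : Set (RN N)) (s p : RN N → RN N → ℝ) (β : RN N → ℝ)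
    (u : RN N → ℝ) : ℝ :=
  luxNorm U β u + wSeminorm U s p u

/-- `Q = (ℝ^N × ℝ^N) \ (Ωᶜ × Ωᶜ)`. -/
def Qset (Ω : Set (RN N)) : Set (RN N × RN N) := univ \ (Ωᶜ ×ˢ Ωᶜ)

/-- Membership in `X₀`. -/
def MemX0 (Ω : Set (RN N)) (s p : RN N → RN N → ℝ) (β : RN N → ℝ)
    (u : RN N → ℝ) : Prop :=
  Measurable u ∧ MemVarLp Ω β u ∧ (∃ l, 0 < l ∧ gmodular (Qset Ω) s p u l < ⊤) ∧
    (∀ᵐ x, x ∉ Ω → u x = 0)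

/-- The `X₀`-norm. -/
def x0Norm (s p : RN N → RN N → ℝ) (u : RN N → ℝ) : ℝ :=
  sInf {l | 0 < l ∧ gmodular univ s p u l < 1}

/-- The modular `ρ_{X₀}`. -/
def rhoX0 (s p : RN N → RN N → ℝ) (u : RN N → ℝ) : ℝ≥0∞ :=
  gmodular univ s p u 1

/-- Carathéodory function. -/
def Caratheodory (f : RN N → ℝ → ℝ) : Prop :=
  (∀ t, Measurable fun x => f x t) ∧ ∀ x, Continuous fun t => f x t

/-- `F(x,t) = ∫₀ᵗ f(x,τ) dτ`. -/
def Fant (f : RN N → ℝ → ℝ) (x : RN N) (t : ℝ) : ℝ := ∫ τ in (0:ℝ)..t, f x τ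

/-- Growth condition (F1) (with data `M` and `r`). -/
def F1 (Ω : Set (RN N)) (f : RN N → ℝ → ℝ) (M : ℝ) (r : RN N → ℝ) : Prop :=
  0 < M ∧ ∀ x ∈ Ω, ∀ t : ℝ, |f x t| ≤ M * |t| ^ (r x - 1)

/-- Ambrosetti–Rabinowitz type condition (F2) (with data `Θ`). -/
def F2 (Ω : Set (RN N)) (f : RN N → ℝ → ℝ) (Θ : ℝ) : Prop :=
  ∀ᵐ x, x ∈ Ω → ∀ t : ℝ, t ≠ 0 →
    0 < Θ * Fant f x t ∧ Θ * Fant f x t ≤ 2 * (t * f x t)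

/-- The left-hand side pairing
`∫∫ |u(x)-u(y)|^{p-2}(u(x)-u(y))(w(x)-w(y)) / |x-y|^{N+sp} dx dy`. -/
def energyLHS (s p : RN N → RN N → ℝ) (u w : RN N → ℝ) : ℝ :=
  ∫ z : RN N × RN N,
    |u z.1 - u z.2| ^ (p z.1 z.2 - 2) * (u z.1 - u z.2) * (w z.1 - w z.2) /
      dist z.1 z.2 ^ ((N : ℝ) + s z.1 z.2 * p z.1 z.2)

/-- The Choquard right-hand side `∫_Ω ∫_Ω F(x,u(x)) f(y,u(y)) w(y) / |x-y|^μ`. -/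
def choquardRHS (Ω : Set (RN N)) (μ : RN N → RN N → ℝ) (f : RN N → ℝ → ℝ)
    (u w : RN N → ℝ) : ℝ :=
  ∫ x in Ω, ∫ y in Ω, Fant f x (u x) * f y (u y) * w y / dist x y ^ μ x y

/-- The energy functional `J`. -/
def Jfun (Ω : Set (RN N)) (s p μ : RN N → RN N → ℝ) (f : RN N → ℝ → ℝ)
    (u : RN N → ℝ) : ℝ :=
  (∫ z : RN N × RN N,
    |u z.1 - u z.2| ^ p z.1 z.2 /
      (p z.1 z.2 * dist z.1 z.2 ^ ((N : ℝ) + s z.1 z.2 * p z.1 z.2)))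
  - (1/2) * ∫ x in Ω, ∫ y in Ω,
      Fant f x (u x) * Fant f y (u y) / dist x y ^ μ x y

/-- `⟨J'(u), w⟩`. -/
def Jderiv (Ω : Set (RN N)) (s p μ : RN N → RN N → ℝ) (f : RN N → ℝ → ℝ)
    (u w : RN N → ℝ) : ℝ :=
  energyLHS s p u w - choquardRHS Ω μ f u w

/-- The perturbed functional `J_λ`. -/
def Jlam (Ω : Set (RN N)) (s p μ : RN N → RN N → ℝ) (f : RN N → ℝ → ℝ)
    (α : RN N → ℝ) (lam : ℝ) (u : RN N → ℝ) : ℝ :=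
  Jfun Ω s p μ f u - lam * ∫ x in Ω, |u x| ^ α x / α x


/-- A set of reals with positive `sInf` is bounded below by that infimum. -/
theorem sInf_le_of_pos {S : Set ℝ} (hS : 0 < sInf S) {t : ℝ} (ht : t ∈ S) : sInf S ≤ t := by
  refine csInf_le ?_ ht
  by_contra h
  rw [Real.sInf_of_not_bddBelow h] at hS
  exact lt_irrefl _ hS

/-- The real-variable estimate behind `le_lintegral_gagliardo`: with
`r = (L b^{-(q-η)})^{1/N}`, the quantity `r^{-(w-η)}` is bounded below by a power of `b`. -/
theorem rpow_mul_le_of_radius {n b r L P Q w : ℝ} (hn : 0 < n) (hb : 1 ≤ b)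
    (hL : 1 ≤ L) (hwn : w ≤ n) (hr : r = (L * b ^ (-Q)) ^ (1 / n)) :
    b ^ (P + Q * w / n) ≤ L * (b ^ P * r ^ (-w)) := by
  have hb0 : 0 < b := by linarith
  have hL0 : 0 < L := by linarith
  have h1 : r ^ (-w) = L ^ (-(w / n)) * b ^ (Q * w / n) := by
    rw [hr, ← Real.rpow_mul (by positivity), Real.mul_rpow (by positivity) (by positivity),
      ← Real.rpow_mul hb0.le]
    congr 2 <;> field_simp
  have h2 : 1 ≤ L * L ^ (-(w / n)) := by
    have : L * L ^ (-(w / n)) = L ^ (1 - w / n) := by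
      rw [sub_eq_add_neg, Real.rpow_add hL0, Real.rpow_one]
    rw [this]
    refine Real.one_le_rpow hL ?_
    have : w / n ≤ 1 := (div_le_one hn).2 hwn
    linarith
  rw [h1, Real.rpow_add hb0]
  have h3 : 0 ≤ b ^ P * b ^ (Q * w / n) := by positivity
  nlinarith [mul_le_mul_of_nonneg_right h2 h3]

/-- Lower bound for the Gagliardo integral in the second variable at a point where `|u|` is large:
on a ball whose volume is twice what Chebyshev's inequality allows for `{|u| ≥ |u x| / 2}`,
at least half of the points `y` satisfy `|u x - u y| ≥ |u x| / 2`. -/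
theorem le_lintegral_gagliardo (hN : 0 < N) (s p : RN N → RN N → ℝ) (q : RN N → ℝ)
    {u : RN N → ℝ} (hu : Measurable u) {C r₀ η v : ℝ}
    (hr₀ : r₀ ≤ 1) (hv0 : 0 < v)
    (hv : volume (Metric.ball (0 : RN N) 1) = ENNReal.ofReal v) (hC : v ≤ 2 * C)
    (hqC : ∫⁻ y in {y | 1 ≤ |u y|}, ENNReal.ofReal |u y| ^ q y ≤ ENNReal.ofReal C)
    {x : RN N} (hq : ∀ y, dist x y < r₀ → q x - η ≤ q y)
    (hp : ∀ y, dist x y < r₀ → p x x - η ≤ p x y) (hpη : 0 ≤ p x x - η)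
    (hs : ∀ y, dist x y < r₀ → s x x * p x x - η ≤ s x y * p x y)
    (hsη : 0 ≤ s x x * p x x - η) (hsN : s x x * p x x - η ≤ N)
    (hb : 1 ≤ |u x| / 2)
    (hbr : (2 * C / v * (|u x| / 2) ^ (-(q x - η))) ^ (1 / (N : ℝ)) ≤ r₀) (hqη : 0 ≤ q x - η) :
    ENNReal.ofReal (|u x| / 2) ^ (p x x - η + (q x - η) * (s x x * p x x - η) / N) ≤
      ENNReal.ofReal (4 * C / v ^ 2) * ∫⁻ y, ENNReal.ofReal (|u x - u y| / 1) ^ p x y /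
        ENNReal.ofReal (dist x y) ^ ((N : ℝ) + s x y * p x y) := by
  set b := |u x| / 2 with hbdef
  set L := 2 * C / v with hL
  set r := (L * b ^ (-(q x - η))) ^ (1 / (N : ℝ)) with hr
  set P := p x x - η with hP
  set Q := q x - η with hQ
  set w := s x x * p x x - η with hw
  have hNR : (0 : ℝ) < N := by exact_mod_cast hN
  have hb0 : 0 < b := by linarith
  have hL1 : 1 ≤ L := by rw [hL, le_div_iff₀ hv0]; linarith
  have hL0 : 0 < L := by linarith
  have hC0 : 0 < C := by linarith
  have hr0 : 0 < r := by positivity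
  have hrN : r ^ N = L * b ^ (-Q) := by
    rw [hr, ← Real.rpow_natCast, ← Real.rpow_mul (by positivity), one_div_mul_cancel hNR.ne',
      Real.rpow_one]
  have hball : volume (Metric.ball x r) = ENNReal.ofReal (2 * C * b ^ (-Q)) := by
    rw [Measure.addHaar_ball_of_pos _ _ hr0, hv, finrank_euclideanSpace_fin, hrN,
      ← ENNReal.ofReal_mul (by positivity)]
    congr 1
    rw [hL]; field_simp
  have hdist : ∀ y ∈ Metric.ball x r, dist x y < r₀ := fun y hy => by
    rw [Metric.mem_ball'] at hy; exact hy.trans_le hbr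
  set B : Set (RN N) := Metric.ball x r ∩ {y | b ≤ |u y|} with hB
  set T : Set (RN N) := Metric.ball x r ∩ {y | b ≤ |u y|}ᶜ with hT
  have hmeas : MeasurableSet {y | b ≤ |u y|} := measurableSet_le measurable_const (by fun_prop)
  have hBm : MeasurableSet B := measurableSet_ball.inter hmeas
  have hTm : MeasurableSet T := measurableSet_ball.inter hmeas.compl
  have hBvol : volume B ≤ ENNReal.ofReal (C * b ^ (-Q)) := by
    have h1 : ENNReal.ofReal (b ^ Q) * volume B ≤ ENNReal.ofReal C := by
      rw [← setLIntegral_const]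
      refine (setLIntegral_mono' hBm fun y hy => ?_).trans
        ((lintegral_mono_set fun y hy => ?_).trans hqC)
      · have hy2 : b ≤ |u y| := hy.2
        rw [ENNReal.ofReal_rpow_of_pos (by linarith)]
        refine ENNReal.ofReal_le_ofReal ?_
        calc b ^ Q ≤ b ^ q y := Real.rpow_le_rpow_of_exponent_le hb (hq y (hdist y hy.1))
          _ ≤ |u y| ^ q y := Real.rpow_le_rpow hb0.le hy2 (by linarith [hq y (hdist y hy.1)])
      · exact hb.trans hy.2
    have h2 : ENNReal.ofReal (b ^ (-Q)) * (ENNReal.ofReal (b ^ Q) * volume B) = volume B := by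
      rw [← mul_assoc, ← ENNReal.ofReal_mul (by positivity), ← Real.rpow_add hb0]
      simp
    rw [← h2, mul_comm C, ENNReal.ofReal_mul (by positivity)]
    gcongr
  have hTvol : ENNReal.ofReal (C * b ^ (-Q)) ≤ volume T := by
    have h1 : volume (Metric.ball x r) = volume B + volume T :=
      (measure_inter_add_sdiff _ hmeas).symm
    rw [hball] at h1
    have h2 : ENNReal.ofReal (2 * C * b ^ (-Q)) =
        ENNReal.ofReal (C * b ^ (-Q)) + ENNReal.ofReal (C * b ^ (-Q)) := by
      rw [← ENNReal.ofReal_add (by positivity) (by positivity)]; congr 1; ring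
    rw [h2] at h1
    have h3 : ENNReal.ofReal (C * b ^ (-Q)) + ENNReal.ofReal (C * b ^ (-Q)) ≤
        ENNReal.ofReal (C * b ^ (-Q)) + volume T := h1.le.trans (by gcongr)
    exact (ENNReal.add_le_add_iff_left ENNReal.ofReal_ne_top).1 h3
  have hint : ∀ y ∈ T, ENNReal.ofReal (b ^ P * r ^ (-(N + w))) ≤
      ENNReal.ofReal (|u x - u y| / 1) ^ p x y /
        ENNReal.ofReal (dist x y) ^ ((N : ℝ) + s x y * p x y) := by
    intro y hy
    have hd := hdist y hy.1
    have hyb : |u y| < b := not_le.1 hy.2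
    have hxy : b ≤ |u x - u y| := by
      have := abs_sub_abs_le_abs_sub (u x) (u y)
      have : |u x| = 2 * b := by rw [hbdef]; ring
      linarith
    have hyr : dist x y < r := by have := hy.1; rwa [Metric.mem_ball'] at this
    rw [div_one, Real.rpow_neg hr0.le, ← div_eq_mul_inv, ENNReal.ofReal_div_of_pos (by positivity)]
    refine ENNReal.div_le_div ?_ ?_
    · rw [ENNReal.ofReal_rpow_of_pos (by linarith)]
      refine ENNReal.ofReal_le_ofReal ?_
      calc b ^ P ≤ b ^ p x y := Real.rpow_le_rpow_of_exponent_le hb (hp y hd)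
        _ ≤ _ := Real.rpow_le_rpow hb0.le hxy (by linarith [hp y hd])
    · have he : 0 ≤ (N : ℝ) + s x y * p x y := by linarith [hs y hd]
      rw [ENNReal.ofReal_rpow_of_nonneg dist_nonneg he]
      refine ENNReal.ofReal_le_ofReal ?_
      calc dist x y ^ ((N : ℝ) + s x y * p x y) ≤ r ^ ((N : ℝ) + s x y * p x y) :=
            Real.rpow_le_rpow dist_nonneg hyr.le he
        _ ≤ r ^ ((N : ℝ) + w) :=
            Real.rpow_le_rpow_of_exponent_ge hr0 (hbr.trans hr₀) (by linarith [hs y hd])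
  have hG : ENNReal.ofReal (b ^ P * r ^ (-(N + w)) * (C * b ^ (-Q))) ≤
      ∫⁻ y, ENNReal.ofReal (|u x - u y| / 1) ^ p x y /
        ENNReal.ofReal (dist x y) ^ ((N : ℝ) + s x y * p x y) := by
    rw [ENNReal.ofReal_mul (by positivity)]
    refine (mul_le_mul_right hTvol _).trans ?_
    rw [← setLIntegral_const]
    exact (setLIntegral_mono' hTm hint).trans (setLIntegral_le_lintegral _ _)
  refine le_trans ?_ (mul_le_mul_right hG _)
  rw [ENNReal.ofReal_rpow_of_pos hb0, ← ENNReal.ofReal_mul (by positivity)]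
  refine ENNReal.ofReal_le_ofReal ((rpow_mul_le_of_radius hNR hb hL1 hsN hr).trans_eq ?_)
  have h1 : C * b ^ (-Q) = v / 2 * r ^ N := by rw [hrN, hL]; field_simp
  have h2 : r ^ (-(N + w)) * r ^ N = r ^ (-w) := by
    rw [← Real.rpow_natCast, ← Real.rpow_add hr0]; congr 1; ring
  rw [h1, show b ^ P * r ^ (-(N + w)) * (v / 2 * r ^ N) =
    v / 2 * b ^ P * (r ^ (-(N + w)) * r ^ N) by ring, h2, hL]
  field_simp
  ring

/-- Uniform bound for the modular `∫ |u|^{q(x)}` over `{|u| ≥ 1}` on the modular unit ball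
of `W^{s(x,y),p(x,x),p(x,y)}(ℝ^N)`. -/
def SuperlevelBound (s p : RN N → RN N → ℝ) (q : RN N → ℝ) : Prop :=
  ∃ C : ℝ, ∀ u : RN N → ℝ, Measurable u → lmodular univ (fun x => p x x) u 1 ≤ 1 →
    gmodular univ s p u 1 ≤ 1 →
    ∫⁻ x in {x | 1 ≤ |u x|}, ENNReal.ofReal |u x| ^ q x ≤ ENNReal.ofReal C

theorem SuperlevelBound.mono {s p : RN N → RN N → ℝ} {q q' : RN N → ℝ}
    (h : SuperlevelBound s p q) (hq : ∀ x, q' x ≤ q x) : SuperlevelBound s p q' := by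
  obtain ⟨C, hC⟩ := h
  refine ⟨C, fun u hu h1 h2 => le_trans (setLIntegral_mono' ?_ fun x hx => ?_) (hC u hu h1 h2)⟩
  · exact measurableSet_le measurable_const (by fun_prop)
  · exact ENNReal.rpow_le_rpow_of_exponent_le (by simpa using hx) (hq x)

theorem setLIntegral_le_one_of_lmodular {β : RN N → ℝ} {u : RN N → ℝ}
    (h : lmodular univ β u 1 ≤ 1) (A : Set (RN N)) :
    ∫⁻ x in A, ENNReal.ofReal |u x| ^ β x ≤ 1 := by
  simp only [lmodular, div_one] at h
  exact (lintegral_mono_set (subset_univ A)).trans h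

theorem superlevelBound_diag (s p : RN N → RN N → ℝ) :
    SuperlevelBound s p (fun x => p x x) :=
  ⟨1, fun u _ h1 _ => by simpa using setLIntegral_le_one_of_lmodular h1 {x | 1 ≤ |u x|}⟩

theorem volume_superlevel_le_one {β : RN N → ℝ} (hβ : ∀ x, 0 ≤ β x) {u : RN N → ℝ}
    (hu : Measurable u) (h : lmodular univ β u 1 ≤ 1) : volume {x | 1 ≤ |u x|} ≤ 1 := by
  refine le_trans ?_ (setLIntegral_le_one_of_lmodular h {x | 1 ≤ |u x|})
  rw [← setLIntegral_one]
  refine setLIntegral_mono' (measurableSet_le measurable_const (by fun_prop)) fun x hx => ?_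
  rw [← ENNReal.rpow_zero (x := ENNReal.ofReal |u x|)]
  exact ENNReal.rpow_le_rpow_of_exponent_le (by simpa using hx) (hβ x)

/-- One bootstrap step: the exponent `q` improves to any `q'` that is below
`p(x,x) + s(x,x) p(x,x) q(x) / N` up to the slack `η`. -/
theorem SuperlevelBound.improve (hN : 0 < N) {s p : RN N → RN N → ℝ} {q q' : RN N → ℝ}
    (hsc : Continuous fun z : RN N × RN N => s z.1 z.2)
    (hpc : Continuous fun z : RN N × RN N => p z.1 z.2) {r₀ η Q : ℝ}
    (hr₀0 : 0 < r₀) (hr₀ : r₀ ≤ 1) (hη0 : 0 ≤ η) (hη : η ≤ 1 / 2)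
    (hq : ∀ x y, dist x y < r₀ → q x - η ≤ q y)
    (hp : ∀ x y, dist x y < r₀ → p x x - η ≤ p x y)
    (hs : ∀ x y, dist x y < r₀ → s x x * p x x - η ≤ s x y * p x y)
    (hp1 : ∀ x, 1 ≤ p x x) (hq1 : ∀ x, 1 ≤ q x)
    (hsη : ∀ x, η ≤ s x x * p x x) (hsN : ∀ x, s x x * p x x ≤ N)
    (hQ : ∀ x, q' x ≤ Q) (hQ0 : 0 ≤ Q)
    (hq' : ∀ x, q' x ≤ p x x - η + (q x - η) * (s x x * p x x - η) / N)
    (h : SuperlevelBound s p q) : SuperlevelBound s p q' := by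
  obtain ⟨C₀, hC₀⟩ := h
  have hNR : (0 : ℝ) < N := by exact_mod_cast hN
  set v := (volume (Metric.ball (0 : RN N) 1)).toReal with hvdef
  have hv0 : 0 < v :=
    ENNReal.toReal_pos (Metric.measure_ball_pos _ _ one_pos).ne' measure_ball_lt_top.ne
  have hv : volume (Metric.ball (0 : RN N) 1) = ENNReal.ofReal v :=
    (ENNReal.ofReal_toReal measure_ball_lt_top.ne).symm
  set C := max C₀ v with hCdef
  have hCv : v ≤ C := le_max_right _ _
  set A := 2 * C / v / r₀ ^ N with hA
  have hA0 : 0 < A := by positivity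
  set M := max 1 (A ^ 2) with hM
  have hM1 : 1 ≤ M := le_max_left _ _
  have hM0 : 0 < M := by linarith
  refine ⟨(2 * M) ^ Q + 2 ^ Q * (4 * C / v ^ 2), fun u hu h1 h2 => ?_⟩
  have hlow : MeasurableSet {x | 1 ≤ |u x|} := measurableSet_le measurable_const (by fun_prop)
  have hhigh : MeasurableSet {x | 2 * M ≤ |u x|} :=
    measurableSet_le measurable_const (by fun_prop)
  set G : RN N → ℝ≥0∞ := fun x => ∫⁻ y, ENNReal.ofReal (|u x - u y| / 1) ^ p x y /
        ENNReal.ofReal (dist x y) ^ ((N : ℝ) + s x y * p x y) with hG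
  have hG1 : ∫⁻ x, G x ≤ 1 := by
    refine le_trans (le_of_eq ?_) h2
    rw [gmodular, Measure.restrict_univ, Measure.volume_eq_prod, lintegral_prod]
    have := hsc.measurable
    have := hpc.measurable
    fun_prop
  have hpt : ∀ x ∈ {x | 2 * M ≤ |u x|}, ENNReal.ofReal |u x| ^ q' x ≤
      ENNReal.ofReal (2 ^ Q * (4 * C / v ^ 2)) * G x := by
    intro x hx
    have hx : 2 * M ≤ |u x| := hx
    have hbM : M ≤ |u x| / 2 := by linarith
    have hb : 1 ≤ |u x| / 2 := hM1.trans hbM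
    have hb0 : 0 < |u x| / 2 := by linarith
    have key := le_lintegral_gagliardo hN s p q hu hr₀ hv0 hv (by linarith : v ≤ 2 * C)
      ((hC₀ u hu h1 h2).trans (ENNReal.ofReal_le_ofReal (le_max_left _ _))) (x := x)
      (hq x) (hp x) (by linarith [hp1 x]) (hs x) (by linarith [hsη x]) (by linarith [hsN x])
      hb ?_ (by linarith [hq1 x])
    · have e1 : ENNReal.ofReal |u x| ^ q' x =
          ENNReal.ofReal 2 ^ q' x * ENNReal.ofReal (|u x| / 2) ^ q' x := by
        rw [← ENNReal.mul_rpow_of_ne_top ENNReal.ofReal_ne_top ENNReal.ofReal_ne_top,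
          ← ENNReal.ofReal_mul (by norm_num)]
        congr 2; ring
      rw [e1, ENNReal.ofReal_mul (by positivity), mul_assoc]
      refine mul_le_mul' ?_ (le_trans ?_ key)
      · rw [ENNReal.ofReal_rpow_of_pos two_pos]
        exact ENNReal.ofReal_le_ofReal
          (Real.rpow_le_rpow_of_exponent_le one_le_two (hQ x))
      · exact ENNReal.rpow_le_rpow_of_exponent_le (by simpa using hb) (hq' x)
    · have hAb : A ≤ (|u x| / 2) ^ (q x - η) := by
        calc A = (A ^ 2) ^ (1 / 2 : ℝ) := by
              rw [← Real.sqrt_eq_rpow, Real.sqrt_sq hA0.le]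
          _ ≤ (|u x| / 2) ^ (1 / 2 : ℝ) :=
              Real.rpow_le_rpow (by positivity) ((le_max_right _ _).trans hbM) (by norm_num)
          _ ≤ _ := Real.rpow_le_rpow_of_exponent_le hb (by linarith [hq1 x])
      have h3 : 2 * C / v * (|u x| / 2) ^ (-(q x - η)) ≤ r₀ ^ N := by
        rw [Real.rpow_neg hb0.le, ← div_eq_mul_inv, div_le_iff₀ (by positivity)]
        rw [hA, div_le_iff₀ (by positivity)] at hAb
        linarith
      calc _ ≤ (r₀ ^ N) ^ (1 / (N : ℝ)) :=
            Real.rpow_le_rpow (by positivity) h3 (by positivity)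
        _ = r₀ := by
            rw [one_div, Real.pow_rpow_inv_natCast hr₀0.le hN.ne']
  have hsub : {x | 1 ≤ |u x|} ⊆
      ({x | 1 ≤ |u x|} ∩ {x | 2 * M ≤ |u x|}ᶜ) ∪ {x | 2 * M ≤ |u x|} := by
    intro x hx
    by_cases h : 2 * M ≤ |u x|
    · exact Or.inr h
    · exact Or.inl ⟨hx, h⟩
  refine (lintegral_mono_set hsub).trans ((lintegral_union_le _ _ _).trans ?_)
  rw [ENNReal.ofReal_add (by positivity) (by positivity)]
  refine add_le_add ?_ ?_
  · calc _ ≤ ∫⁻ _ in {x | 1 ≤ |u x|} ∩ {x | 2 * M ≤ |u x|}ᶜ, ENNReal.ofReal ((2 * M) ^ Q) := by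
          refine setLIntegral_mono' (hlow.inter hhigh.compl) fun x hx => ?_
          have hx1 : 1 ≤ |u x| := hx.1
          have hx2 : |u x| < 2 * M := not_le.1 hx.2
          rw [ENNReal.ofReal_rpow_of_pos (by linarith)]
          refine ENNReal.ofReal_le_ofReal ?_
          exact (Real.rpow_le_rpow_of_exponent_le hx1 (hQ x)).trans
            (Real.rpow_le_rpow (abs_nonneg _) hx2.le hQ0)
      _ ≤ ENNReal.ofReal ((2 * M) ^ Q) * 1 := by
          rw [setLIntegral_const]
          gcongr
          exact (measure_mono inter_subset_left).trans
            (volume_superlevel_le_one (fun x => by linarith [hp1 x]) hu h1)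
      _ = _ := mul_one _
  · calc _ ≤ ∫⁻ x in {x | 2 * M ≤ |u x|}, ENNReal.ofReal (2 ^ Q * (4 * C / v ^ 2)) * G x :=
          setLIntegral_mono' hhigh hpt
      _ ≤ ∫⁻ x, ENNReal.ofReal (2 ^ Q * (4 * C / v ^ 2)) * G x := setLIntegral_le_lintegral _ _
      _ = ENNReal.ofReal (2 ^ Q * (4 * C / v ^ 2)) * ∫⁻ x, G x :=
          lintegral_const_mul' _ _ ENNReal.ofReal_ne_top
      _ ≤ ENNReal.ofReal (2 ^ Q * (4 * C / v ^ 2)) * 1 := by gcongr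
      _ = _ := mul_one _

theorem _root_.UniformContinuous.comp_of_isCompact {X : Type*} [UniformSpace X] {f g : X → ℝ}
    (hf : UniformContinuous f) (hg : UniformContinuous g) {K : Set (ℝ × ℝ)} (hK : IsCompact K)
    (hfg : ∀ x, (f x, g x) ∈ K) {F : ℝ × ℝ → ℝ} (hF : ContinuousOn F K) :
    UniformContinuous fun x => F (f x, g x) := by
  have h := hK.uniformContinuousOn_of_continuous hF
  rw [← uniformContinuousOn_univ]
  exact h.comp (hf.prodMk hg).uniformContinuousOn fun x _ => hfg x

/-- The bootstrap reaches every exponent that is uniformly below the critical one. -/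
theorem superlevelBound_of_subcritical {s p : RN N → RN N → ℝ} {γ : RN N → ℝ}
    (hs : S1 s) (hp : P1 s p)
    (hsu : UniformContinuous fun z : RN N × RN N => s z.1 z.2)
    (hpu : UniformContinuous fun z : RN N × RN N => p z.1 z.2)
    {δ : ℝ} (hδ : 0 < δ) (hγ : ∀ x, γ x ≤ pstar s p x - δ) : SuperlevelBound s p γ := by
  obtain ⟨hsc, -, hsb, hs0, -⟩ := hs
  obtain ⟨⟨hpc, hp1, hpb⟩, -, hspN⟩ := hp
  set a := inf2 s with ha
  set S := sup2 s with hS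
  set P := sup2 p with hP
  have hsa : ∀ x y, a ≤ s x y := fun x y => sInf_le_of_pos hs0 ⟨x, y, rfl⟩
  have hsS : ∀ x y, s x y ≤ S := fun x y => le_csSup hsb ⟨x, y, rfl⟩
  have hp1' : ∀ x y, 1 ≤ p x y := fun x y =>
    hp1.le.trans (sInf_le_of_pos (by unfold inf2 at hp1; linarith) ⟨x, y, rfl⟩)
  have hpP : ∀ x y, p x y ≤ P := fun x y => le_csSup hpb ⟨x, y, rfl⟩
  have hS0 : 0 < S := hs0.trans_le ((hsa 0 0).trans (hsS 0 0))
  have hP1 : 1 ≤ P := (hp1' 0 0).trans (hpP 0 0)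
  have hNR : (0 : ℝ) < N := lt_trans (by positivity) hspN
  have hN : 0 < N := by exact_mod_cast hNR
  set κ := S * P / N with hκ
  have hκ0 : 0 < κ := by positivity
  have hκ1 : κ < 1 := (div_lt_one hNR).2 hspN
  set K : Set (ℝ × ℝ) := Icc 0 S ×ˢ Icc 1 P with hK
  have hKc : IsCompact K := isCompact_Icc.prod isCompact_Icc
  have hKN : ∀ z ∈ K, (N : ℝ) - S * P ≤ N - z.1 * z.2 := by
    rintro ⟨z, w⟩ ⟨⟨h1, h2⟩, h3, h4⟩
    have : z * w ≤ S * P := mul_le_mul h2 h4 (by simp at h3; linarith) hS0.le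
    simp only; linarith
  have hmem : ∀ z : RN N × RN N, (s z.1 z.2, p z.1 z.2) ∈ K := fun z =>
    ⟨⟨hs0.le.trans (hsa _ _), hsS _ _⟩, hp1' _ _, hpP _ _⟩
  have hden : ∀ x, 0 < N - s x x * p x x := fun x =>
    lt_of_lt_of_le (by linarith) (hKN _ (hmem (x, x)))
  have hps : ∀ x, pstar s p x = p x x + s x x * p x x / N * pstar s p x := fun x => by
    have h : pstar s p x * (N - s x x * p x x) = N * p x x := div_mul_cancel₀ _ (hden x).ne'
    field_simp
    linarith
  have haw : ∀ x, a ≤ s x x * p x x := fun x => by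
    nlinarith [hsa x x, hp1' x x]
  have hwκ : ∀ x, s x x * p x x / N ≤ κ := fun x => by
    rw [hκ]
    exact div_le_div_of_nonneg_right (by linarith [hKN _ (hmem (x, x))]) hNR.le
  have hpps : ∀ x, p x x ≤ pstar s p x := fun x => by
    unfold pstar
    rw [le_div_iff₀ (hden x)]
    nlinarith [haw x, hp1' x x]
  set Q := N * P / (N - S * P) with hQ
  have hpsQ : ∀ x, pstar s p x ≤ Q := fun x => by
    have := hKN _ (hmem (x, x))
    have := hpP x x
    unfold pstar
    rw [hQ]
    have : 0 < N - S * P := by linarith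
    gcongr
  have hQ1 : 1 ≤ Q := (hp1' 0 0).trans ((hpps 0).trans (hpsQ 0))
  set q : ℝ → RN N → ℝ := fun t x => pstar s p x - t * (pstar s p x - p x x) with hq
  set κ' := (1 + κ) / 2 with hκ'
  have hstep : ∀ t, 0 < t → t ≤ 1 → SuperlevelBound s p (q t) →
      SuperlevelBound s p (q (κ' * t)) := by
    intro t ht ht1 h
    set η := min (min (1 / 2) a) ((κ' - κ) * t * (a / N) / (2 + Q / N)) with hη
    have hκκ : 0 < κ' - κ := by rw [hκ']; linarith
    have hη0 : 0 < η := by positivity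
    have hηhalf : η ≤ 1 / 2 := (min_le_left _ _).trans (min_le_left _ _)
    have hηa : η ≤ a := (min_le_left _ _).trans (min_le_right _ _)
    have hηm : η * (2 + Q / N) ≤ (κ' - κ) * t * (a / N) := by
      rw [← le_div_iff₀ (by positivity)]; exact min_le_right _ _
    have hw : UniformContinuous fun z : RN N × RN N => s z.1 z.2 * p z.1 z.2 :=
      hsu.comp_of_isCompact hpu hKc hmem (F := fun z => z.1 * z.2) (by fun_prop)
    have hqu : UniformContinuous fun z : RN N × RN N =>
        N * p z.1 z.2 / (N - s z.1 z.2 * p z.1 z.2) -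
          t * (N * p z.1 z.2 / (N - s z.1 z.2 * p z.1 z.2) - p z.1 z.2) := by
      have hF : ContinuousOn (fun z : ℝ × ℝ => N * z.2 / (N - z.1 * z.2)) K :=
        ContinuousOn.div (by fun_prop) (by fun_prop) fun z hz =>
          (lt_of_lt_of_le (by linarith) (hKN z hz)).ne'
      exact hsu.comp_of_isCompact hpu hKc hmem
        (F := fun z => N * z.2 / (N - z.1 * z.2) - t * (N * z.2 / (N - z.1 * z.2) - z.2))
        (by fun_prop)
    obtain ⟨r₁, hr₁, h₁⟩ := Metric.uniformContinuous_iff.1 hpu η hη0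
    obtain ⟨r₂, hr₂, h₂⟩ := Metric.uniformContinuous_iff.1 hw η hη0
    obtain ⟨r₃, hr₃, h₃⟩ := Metric.uniformContinuous_iff.1 hqu η hη0
    set r₀ := min 1 (min r₁ (min r₂ r₃)) with hr₀
    have hr₀0 : 0 < r₀ := by positivity
    have hr₀₁ : r₀ ≤ r₁ := (min_le_right _ _).trans (min_le_left _ _)
    have hr₀₂ : r₀ ≤ r₂ := (min_le_right _ _).trans ((min_le_right _ _).trans (min_le_left _ _))
    have hr₀₃ : r₀ ≤ r₃ := (min_le_right _ _).trans ((min_le_right _ _).trans (min_le_right _ _))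
    have hdxy : ∀ x y : RN N, dist (x, x) (x, y) = dist x y := fun x y => by
      simp [Prod.dist_eq]
    have hdyy : ∀ x y : RN N, dist (x, x) (y, y) = dist x y := fun x y => by
      simp [Prod.dist_eq]
    refine h.improve hN hsc hpc (r₀ := r₀) (η := η) (Q := Q) hr₀0 (min_le_left _ _) hη0.le hηhalf
      (fun x y hd => ?_) (fun x y hd => ?_) (fun x y hd => ?_) (fun x => hp1' x x) (fun x => ?_)
      (fun x => hηa.trans (haw x)) (fun x => by linarith [hden x]) (fun x => ?_) (by linarith)
      (fun x => ?_)
    · have := h₃ (a := (x, x)) (b := (y, y)) (by rw [hdyy]; linarith)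
      have := (abs_lt.1 this).2
      simp only [hq, pstar] at this ⊢
      linarith
    · have := h₁ (a := (x, x)) (b := (x, y)) (by rw [hdxy]; linarith)
      have := (abs_lt.1 this).2
      simp only at this
      linarith
    · have := h₂ (a := (x, x)) (b := (x, y)) (by rw [hdxy]; linarith)
      have := (abs_lt.1 this).2
      simp only at this
      linarith
    · simp only [hq]
      nlinarith [hpps x, hp1' x x]
    · have : 0 ≤ κ' * t * (pstar s p x - p x x) := by
        have := hpps x
        have : 0 ≤ pstar s p x - p x x := by linarith
        positivity
      simp only [hq]
      linarith [hpsQ x]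
    · set w := s x x * p x x / N with hwdef
      have hwN : s x x * p x x = w * N := by rw [hwdef]; field_simp
      set D := pstar s p x - p x x with hD
      have hw1 : w ≤ 1 := (hwκ x).trans hκ1.le
      have hDw : D = w * pstar s p x := by rw [hD]; linarith [hps x]
      have haN : a / N ≤ w := by rw [hwdef]; gcongr; exact haw x
      have hw0 : 0 < w := lt_of_lt_of_le (by positivity) haN
      have hDa : a / N ≤ D := by
        rw [hDw]
        nlinarith [hpps x, hp1' x x]
      have hD0 : 0 < D := lt_of_lt_of_le (by positivity) hDa
      have hqQ : q t x / N ≤ Q / N := by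
        gcongr
        have : 0 ≤ t * D := by positivity
        simp only [hq]
        linarith [hpsQ x]
      have e1 : (q t x - η) * (s x x * p x x - η) / N =
          q t x * w - η * (w + q t x / N) + η ^ 2 / N := by
        rw [hwN]; field_simp; ring
      have e2 : q t x = pstar s p x - t * D := rfl
      have e3 : q (κ' * t) x = pstar s p x - κ' * t * D := rfl
      have h4 : 0 ≤ η ^ 2 / N := by positivity
      have h5 : η * (1 + w + q t x / N) ≤ (κ' - κ) * t * D := by
        calc η * (1 + w + q t x / N) ≤ η * (2 + Q / N) := by
              apply mul_le_mul_of_nonneg_left _ hη0.le; linarith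
          _ ≤ (κ' - κ) * t * (a / N) := hηm
          _ ≤ _ := by gcongr
      have h6 : w * (t * D) ≤ κ * (t * D) :=
        mul_le_mul_of_nonneg_right (hwκ x) (by positivity)
      have h7 : q t x * w = D - w * (t * D) := by rw [e2, hDw]; ring
      rw [e1, e3, h7]
      linarith
  have hκ'0 : 0 < κ' := by positivity
  have hκ'1 : κ' < 1 := by rw [hκ']; linarith
  have hall : ∀ k : ℕ, SuperlevelBound s p (q (κ' ^ k)) := by
    intro k
    induction k with
    | zero => exact (superlevelBound_diag s p).mono fun x => by simp [hq]
    | succ k ih =>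
      rw [pow_succ']
      exact hstep _ (by positivity) (pow_le_one₀ hκ'0.le hκ'1.le) ih
  obtain ⟨k, hk⟩ := exists_pow_lt_of_lt_one (show 0 < δ / Q by positivity) hκ'1
  refine (hall k).mono fun x => ?_
  have h1 : κ' ^ k * Q ≤ δ := by
    rw [lt_div_iff₀ (by positivity)] at hk; exact hk.le
  have h2 : κ' ^ k * (pstar s p x - p x x) ≤ κ' ^ k * Q := by
    gcongr
    linarith [hpsQ x, hp1' x x]
  simp only [hq]
  linarith [hγ x]

/-- A bound on the superlevel set upgrades to a bound of the whole modular. -/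
theorem SuperlevelBound.exists_lmodular_le {s p : RN N → RN N → ℝ} {γ : RN N → ℝ}
    (h : SuperlevelBound s p γ) (hγp : ∀ x, p x x ≤ γ x) :
    ∃ C : ℝ, 1 ≤ C ∧ ∀ u : RN N → ℝ, Measurable u → lmodular univ (fun x => p x x) u 1 ≤ 1 →
      gmodular univ s p u 1 ≤ 1 → lmodular univ γ u 1 ≤ ENNReal.ofReal C := by
  obtain ⟨C, hC⟩ := h
  refine ⟨1 + max C 0, by simp, fun u hu h1 h2 => ?_⟩
  have hm : MeasurableSet {x | 1 ≤ |u x|} := measurableSet_le measurable_const (by fun_prop)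
  simp only [lmodular, div_one, Measure.restrict_univ]
  rw [← lintegral_add_compl _ hm, add_comm, ENNReal.ofReal_add zero_le_one (by simp)]
  refine add_le_add ?_ ((hC u hu h1 h2).trans (ENNReal.ofReal_le_ofReal (le_max_left _ _)))
  rw [ENNReal.ofReal_one]
  refine le_trans ?_ (setLIntegral_le_one_of_lmodular h1 {x | 1 ≤ |u x|}ᶜ)
  refine setLIntegral_mono' hm.compl fun x hx => ?_
  refine ENNReal.rpow_le_rpow_of_exponent_ge ?_ (hγp x)
  have : |u x| < 1 := not_le.1 hx
  simpa using this.le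

theorem lmodular_div {U : Set (RN N)} {β : RN N → ℝ} {u : RN N → ℝ} {l : ℝ} (hl : 0 < l) :
    lmodular U β (fun x => u x / l) 1 = lmodular U β u l := by
  simp only [lmodular, abs_div, abs_of_pos hl, div_one]

theorem gmodular_div {A : Set (RN N × RN N)} {s p : RN N → RN N → ℝ} {u : RN N → ℝ} {l : ℝ}
    (hl : 0 < l) : gmodular A s p (fun x => u x / l) 1 = gmodular A s p u l := by
  simp only [gmodular, ← sub_div, abs_div, abs_of_pos hl, div_one]

/-- Enlarging the scale by `c ≥ 1` divides a modular with exponents at least `1` by `c`. -/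
theorem lmodular_mul_le {U : Set (RN N)} {β : RN N → ℝ} (hβ : ∀ x, 1 ≤ β x) {u : RN N → ℝ}
    {l c : ℝ} (hl : 0 < l) (hc : 1 ≤ c) :
    lmodular U β u (l * c) ≤ ENNReal.ofReal c⁻¹ * lmodular U β u l := by
  have hc0 : 0 < c := by linarith
  unfold lmodular
  rw [← lintegral_const_mul' _ _ ENNReal.ofReal_ne_top]
  refine lintegral_mono fun x => ?_
  have h1 : |u x| / (l * c) = c⁻¹ * (|u x| / l) := by field_simp
  rw [h1, ENNReal.ofReal_mul (by positivity), ENNReal.mul_rpow_of_nonneg _ _ (by linarith [hβ x])]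
  gcongr
  refine (ENNReal.rpow_le_rpow_of_exponent_ge ?_ (hβ x)).trans_eq (ENNReal.rpow_one _)
  simpa using inv_le_one_of_one_le₀ hc

theorem gmodular_mul_le {A : Set (RN N × RN N)} {s p : RN N → RN N → ℝ} (hp : ∀ x y, 1 ≤ p x y)
    {u : RN N → ℝ} {l c : ℝ} (hl : 0 < l) (hc : 1 ≤ c) :
    gmodular A s p u (l * c) ≤ ENNReal.ofReal c⁻¹ * gmodular A s p u l := by
  have hc0 : 0 < c := by linarith
  unfold gmodular
  rw [← lintegral_const_mul' _ _ ENNReal.ofReal_ne_top]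
  refine lintegral_mono fun z => ?_
  have h1 : |u z.1 - u z.2| / (l * c) = c⁻¹ * (|u z.1 - u z.2| / l) := by field_simp
  rw [h1, ENNReal.ofReal_mul (by positivity),
    ENNReal.mul_rpow_of_nonneg _ _ (by linarith [hp z.1 z.2]), ← mul_div_assoc]
  gcongr
  refine (ENNReal.rpow_le_rpow_of_exponent_ge ?_ (hp _ _)).trans_eq (ENNReal.rpow_one _)
  simpa using inv_le_one_of_one_le₀ hc

theorem exists_ofReal_inv_mul_lt_one {m : ℝ≥0∞} (hm : m < ⊤) :
    ∃ c : ℝ, 1 ≤ c ∧ ENNReal.ofReal c⁻¹ * m < 1 := by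
  have h0 : 0 ≤ m.toReal := ENNReal.toReal_nonneg
  refine ⟨m.toReal + 1, by linarith, ?_⟩
  rw [← ENNReal.ofReal_toReal hm.ne, ENNReal.toReal_ofReal h0,
    ← ENNReal.ofReal_mul (by positivity), ENNReal.ofReal_lt_one, inv_mul_lt_iff₀ (by linarith)]
  linarith

theorem lmodular_le_one_of_le {U : Set (RN N)} {β : RN N → ℝ} (hβ : ∀ x, 1 ≤ β x)
    {u : RN N → ℝ} {l l' : ℝ} (hl : 0 < l) (hll : l ≤ l') (h : lmodular U β u l ≤ 1) :
    lmodular U β u l' ≤ 1 := by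
  have hc : 1 ≤ l' / l := (one_le_div hl).2 hll
  have := lmodular_mul_le (U := U) (u := u) hβ hl hc
  rw [mul_div_cancel₀ _ hl.ne'] at this
  refine this.trans (mul_le_one' ?_ h)
  simpa using (div_le_one (by linarith)).2 hll

theorem gmodular_le_one_of_le {A : Set (RN N × RN N)} {s p : RN N → RN N → ℝ}
    (hp : ∀ x y, 1 ≤ p x y) {u : RN N → ℝ} {l l' : ℝ} (hl : 0 < l) (hll : l ≤ l')
    (h : gmodular A s p u l ≤ 1) : gmodular A s p u l' ≤ 1 := by
  have hc : 1 ≤ l' / l := (one_le_div hl).2 hll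
  have := gmodular_mul_le (A := A) (s := s) (u := u) hp hl hc
  rw [mul_div_cancel₀ _ hl.ne'] at this
  refine this.trans (mul_le_one' ?_ h)
  simpa using (div_le_one (by linarith)).2 hll

/-- Continuous embedding `W^{s(x,y),p(x,x),p(x,y)}(ℝ^N) ↪ L^{γ(x)}(ℝ^N)`
(Theorem "Sobolev for unbounded"). -/
theorem statement4 {N : ℕ} (s p : RN N → RN N → ℝ) (γ : RN N → ℝ)
    (hs : S1 s) (hp : P1 s p)
    (hsu : UniformContinuous fun z : RN N × RN N => s z.1 z.2)
    (hpu : UniformContinuous fun z : RN N × RN N => p z.1 z.2)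
    (hγ : CPlusOn univ γ) (hγu : UniformContinuous γ)
    (hγp : ∀ x, p x x ≤ γ x)
    (hgap : 0 < sInf {t | ∃ x, pstar s p x - γ x = t}) :
    ∃ K : ℝ, 0 < K ∧ ∀ u : RN N → ℝ, MemW univ s p (fun x => p x x) u →
      luxNorm univ γ u ≤ K * wNorm univ s p (fun x => p x x) u := by
  have hp1 : ∀ x y, 1 ≤ p x y := fun x y =>
    hp.1.2.1.le.trans (sInf_le_of_pos (one_pos.trans hp.1.2.1) ⟨x, y, rfl⟩)
  have hγ1 : ∀ x, 1 ≤ γ x := fun x => (hp1 x x).trans (hγp x)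
  obtain ⟨C, hC1, hC⟩ := (superlevelBound_of_subcritical hs hp hsu hpu hgap fun x =>
    le_sub_comm.1 (sInf_le_of_pos hgap ⟨x, rfl⟩)).exists_lmodular_le hγp
  have hC0 : 0 < C := by linarith
  refine ⟨C, hC0, fun u hu => ?_⟩
  obtain ⟨⟨hum, l₁, hl₁, h₁⟩, l₂, hl₂, h₂⟩ := hu
  set A := {l | 0 < l ∧ lmodular univ (fun x => p x x) u l ≤ 1} with hA
  set B := {l | 0 < l ∧ gmodular (univ ×ˢ univ) s p u l < 1} with hB
  have hAne : A.Nonempty := by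
    obtain ⟨c, hc, h⟩ := exists_ofReal_inv_mul_lt_one h₁
    exact ⟨l₁ * c, by positivity, (lmodular_mul_le (fun x => hp1 x x) hl₁ hc).trans h.le⟩
  have hBne : B.Nonempty := by
    obtain ⟨c, hc, h⟩ := exists_ofReal_inv_mul_lt_one h₂
    exact ⟨l₂ * c, by positivity, (gmodular_mul_le hp1 hl₂ hc).trans_lt h⟩
  have key : ∀ a ∈ A, ∀ b ∈ B, luxNorm univ γ u / C ≤ a + b := by
    rintro a ⟨ha, ha'⟩ b ⟨hb, hb'⟩
    have hab : 0 < a + b := by positivity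
    rw [univ_prod_univ] at hb'
    have h := hC (fun x => u x / (a + b)) (hum.div_const _)
      (by rw [lmodular_div hab]
          exact lmodular_le_one_of_le (fun x => hp1 x x) ha (by linarith) ha')
      (by rw [gmodular_div hab]
          exact gmodular_le_one_of_le hp1 hb (by linarith) hb'.le)
    rw [lmodular_div hab] at h
    rw [div_le_iff₀ hC0]
    refine csInf_le ⟨0, fun l hl => hl.1.le⟩ ⟨by positivity, ?_⟩
    refine (lmodular_mul_le hγ1 hab hC1).trans ((mul_le_mul_right h _).trans_eq ?_)
    rw [← ENNReal.ofReal_mul (by positivity), inv_mul_cancel₀ hC0.ne', ENNReal.ofReal_one]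
  have h1 : ∀ b ∈ B, luxNorm univ γ u / C - b ≤ sInf A := fun b hb =>
    le_csInf hAne fun a ha => by linarith [key a ha b hb]
  have h2 : luxNorm univ γ u / C - sInf A ≤ sInf B :=
    le_csInf hBne fun b hb => by linarith [h1 b hb]
  have h3 : luxNorm univ γ u / C ≤ wNorm univ s p (fun x => p x x) u := by
    change _ ≤ sInf A + sInf B
    linarith
  rw [div_le_iff₀ hC0] at h3
  linarith

end VarOrderChoquard
end
end

section
/- Let Ω ⊂ ℝ^N (N ≥ 2) be a smooth bounded domain and let s, p satisfy (S1), (P1). Let β ∈ C₊(Ω̄) with p(x,x) ≤ β(x) < p_s*(x) for all x ∈ Ω̄. Then for any γ ∈ C₊(Ω̄) with 1 < γ(x) < p_s*(x) for all x ∈ Ω̄, there exists C = C(N,s,p,γ,β,Ω) > 0 such that ‖u‖_{L^{γ(x)}(Ω)} ≤ C‖u‖_{X₀} for every u ∈ X₀. Moreover this embedding is compact: every bounded sequence in X₀ has a subsequence converging strongly in L^{γ(x)}(Ω). -/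
open MeasureTheory Set Filter ENNReal

noncomputable section

namespace VarOrderChoquard

variable {N : ℕ}

/-- The Gagliardo kernel, i.e. the integrand of `gmodular` at scale `1`. -/
def gkernel (s p : RN N → RN N → ℝ) (u : RN N → ℝ) (x y : RN N) : ℝ≥0∞ :=
  ENNReal.ofReal |u x - u y| ^ p x y / ENNReal.ofReal (dist x y) ^ ((N : ℝ) + s x y * p x y)

/-- The inner integral of the Gagliardo modular. -/
def gdensity (s p : RN N → RN N → ℝ) (u : RN N → ℝ) (x : RN N) : ℝ≥0∞ :=
  ∫⁻ y, gkernel s p u x y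

/-- Uniform bounds and continuity of the order `s` and the exponent `p`. -/
structure UniformExponents (s p : RN N → RN N → ℝ) (σ q₀ P c : ℝ) : Prop where
  continuous_s : Continuous (fun z : RN N × RN N => s z.1 z.2)
  continuous_p : Continuous (fun z : RN N × RN N => p z.1 z.2)
  pos_order : 0 < σ
  order_ge : ∀ x y, σ ≤ s x y
  order_le : ∀ x y, s x y ≤ 1
  one_lt : 1 < q₀
  exponent_ge : ∀ x y, q₀ ≤ p x y
  exponent_le : ∀ x y, p x y ≤ P
  pos_gap : 0 < c
  mul_le : ∀ x y, s x y * p x y ≤ N - c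

theorem exists_uniformExponents {s p : RN N → RN N → ℝ} (hs : S1 s) (hp : P1 s p) :
    ∃ σ q₀ P c, UniformExponents s p σ q₀ P c := by
  obtain ⟨hsc, -, hsb, hs0, hs1⟩ := hs
  obtain ⟨⟨hpc, hp1, hpb⟩, -, hsp⟩ := hp
  have below : ∀ (f : RN N → RN N → ℝ), 0 < inf2 f → ∀ x y, inf2 f ≤ f x y := by
    intro f hf x y
    refine csInf_le ?_ ⟨x, y, rfl⟩
    by_contra h
    have h0 : inf2 f = 0 := Real.sInf_of_not_bddBelow h
    exact hf.ne' h0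
  have hs_le : ∀ x y, s x y ≤ sup2 s := fun x y => le_csSup hsb ⟨x, y, rfl⟩
  have hp_le : ∀ x y, p x y ≤ sup2 p := fun x y => le_csSup hpb ⟨x, y, rfl⟩
  have hsl := below s hs0
  have hpl := below p (by linarith)
  refine ⟨inf2 s, inf2 p, sup2 p, N - sup2 s * sup2 p, hsc, hpc, hs0, hsl,
    fun x y => (hs_le x y).trans hs1.le, hp1, hpl, hp_le, by linarith, fun x y => ?_⟩
  have h1 := mul_le_mul (hs_le x y) (hp_le x y) (by linarith [hpl x y])
    (hs0.le.trans ((hsl x y).trans (hs_le x y)))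
  linarith

/-- Young-type splitting of a difference into a constant and a kernel part. -/
theorem le_add_mul_rpow_div {D d r t τ q p l n : ℝ} (hD : 0 ≤ D) (hd : 0 < d) (hdr : d ≤ r)
    (hr : r ≤ 1) (ht : 0 ≤ t) (htτ : t ≤ τ) (hq : 1 ≤ q) (hqp : q ≤ p) (hl : 1 ≤ l)
    (hn : 0 ≤ n) :
    D ≤ r ^ t * l + r ^ t * l ^ (1 - q) * r ^ n * (D ^ p / d ^ (n + τ * p)) := by
  have hr0 : 0 < r := hd.trans_le hdr
  have hl0 : 0 < l := by linarith
  have hrt : 0 < r ^ t := Real.rpow_pos_of_pos hr0 t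
  rcases le_or_gt D (r ^ t * l) with h | h
  · have : 0 ≤ r ^ t * l ^ (1 - q) * r ^ n * (D ^ p / d ^ (n + τ * p)) := by positivity
    linarith
  have hD0 : 0 < D := lt_trans (by positivity) h
  have h1 : D = D ^ p * D ^ (1 - p) := by
    rw [← Real.rpow_add hD0]; simp
  have h2 : D ^ (1 - p) ≤ (r ^ t * l) ^ (1 - p) :=
    Real.rpow_le_rpow_of_nonpos (by positivity) h.le (by linarith)
  have h3 : (r ^ t * l) ^ (1 - p) ≤ r ^ (t * (1 - p)) * l ^ (1 - q) := by
    rw [Real.mul_rpow hrt.le hl0.le, ← Real.rpow_mul hr0.le]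
    gcongr
  have h4 : d ^ (n + τ * p) ≤ r ^ (n + t * p) := by
    calc d ^ (n + τ * p) ≤ d ^ (n + t * p) :=
          Real.rpow_le_rpow_of_exponent_ge hd (hdr.trans hr)
            (by nlinarith)
      _ ≤ r ^ (n + t * p) := Real.rpow_le_rpow hd.le hdr (by nlinarith)
  have h5 : D ^ p ≤ r ^ (n + t * p) * (D ^ p / d ^ (n + τ * p)) := by
    have : D ^ p = d ^ (n + τ * p) * (D ^ p / d ^ (n + τ * p)) := by
      field_simp
    calc D ^ p = d ^ (n + τ * p) * (D ^ p / d ^ (n + τ * p)) := this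
      _ ≤ _ := by gcongr
  have h6 : r ^ (n + t * p) * r ^ (t * (1 - p)) = r ^ t * r ^ n := by
    rw [← Real.rpow_add hr0, ← Real.rpow_add hr0]; congr 1; ring
  calc D = D ^ p * D ^ (1 - p) := h1
    _ ≤ (r ^ (n + t * p) * (D ^ p / d ^ (n + τ * p))) * (r ^ (t * (1 - p)) * l ^ (1 - q)) := by
        gcongr
        exact h2.trans h3
    _ = (r ^ (n + t * p) * r ^ (t * (1 - p))) * l ^ (1 - q) * (D ^ p / d ^ (n + τ * p)) := by ring
    _ = r ^ t * l ^ (1 - q) * r ^ n * (D ^ p / d ^ (n + τ * p)) := by rw [h6]; ring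
    _ ≤ _ := by linarith [mul_pos hrt hl0]

theorem le_add_mul_rpow {a μ m m₁ : ℝ} (ha : 0 ≤ a) (hμ : 1 ≤ μ) (hm : 1 ≤ m) (hm₁ : m₁ ≤ m) :
    a ≤ μ + μ ^ (1 - m₁) * a ^ m := by
  have hμ0 : 0 < μ := by linarith
  rcases le_or_gt a μ with h | h
  · have : 0 ≤ μ ^ (1 - m₁) * a ^ m := by positivity
    linarith
  have ha0 : 0 < a := hμ0.trans h
  have h1 : a = a ^ (1 - m) * a ^ m := by
    rw [← Real.rpow_add ha0]; simp
  have h2 : a ^ (1 - m) ≤ μ ^ (1 - m₁) :=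
    (Real.rpow_le_rpow_of_nonpos hμ0 h.le (by linarith)).trans
      (Real.rpow_le_rpow_of_exponent_le hμ (by linarith))
  calc a = a ^ (1 - m) * a ^ m := h1
    _ ≤ μ ^ (1 - m₁) * a ^ m := by gcongr
    _ ≤ _ := by linarith

theorem rpow_le_one_add_rpow {a g m : ℝ} (ha : 0 ≤ a) (hg : 0 ≤ g) (hgm : g ≤ m) :
    a ^ g ≤ 1 + a ^ m := by
  rcases le_or_gt a 1 with h | h
  · have := Real.rpow_le_one ha h hg
    have := Real.rpow_nonneg ha m
    linarith
  · have := Real.rpow_le_rpow_of_exponent_le h.le hgm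
    linarith

/-- Interpolation of a power between the first power and a strictly larger one. -/
theorem exists_rpow_le_add {M ε τ : ℝ} (hε : 0 < ε) (hτ : 0 < τ) :
    ∃ K : ℝ, 0 < K ∧ ∀ a g m : ℝ, 0 ≤ a → 1 ≤ g → g ≤ M → g + ε ≤ m →
      a ^ g ≤ τ * a ^ m + K * a := by
  set T : ℝ := max 1 (τ ^ (-(1 / ε))) with hT
  have hT1 : 1 ≤ T := le_max_left _ _
  have hTε : T ^ (-ε) ≤ τ := by
    have h1 : (τ ^ (-(1 / ε))) ^ (-ε) = τ := by
      rw [← Real.rpow_mul hτ.le]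
      have : -(1 / ε) * -ε = 1 := by field_simp
      rw [this, Real.rpow_one]
    calc T ^ (-ε) ≤ (τ ^ (-(1 / ε))) ^ (-ε) :=
          Real.rpow_le_rpow_of_nonpos (by positivity) (le_max_right _ _) (by linarith)
      _ = τ := h1
  refine ⟨T ^ M, by positivity, fun a g m ha hg hgM hgm => ?_⟩
  rcases eq_or_lt_of_le ha with rfl | ha0
  · rw [Real.zero_rpow (by linarith), Real.zero_rpow (by linarith)]; simp
  rcases le_or_gt a T with h | h
  · have h1 : a ^ g = a ^ (g - 1) * a := by
      rw [← Real.rpow_add_one ha0.ne']; simp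
    have h2 : a ^ (g - 1) ≤ T ^ M :=
      (Real.rpow_le_rpow ha h (by linarith)).trans
        (Real.rpow_le_rpow_of_exponent_le hT1 (by linarith))
    have h3 : 0 ≤ τ * a ^ m := by positivity
    rw [h1]
    have := mul_le_mul_of_nonneg_right h2 ha
    linarith
  · have h1 : a ^ g ≤ a ^ (-ε) * a ^ m := by
      rw [← Real.rpow_add ha0]
      exact Real.rpow_le_rpow_of_exponent_le (by linarith) (by linarith)
    have h2 : a ^ (-ε) ≤ τ :=
      (Real.rpow_le_rpow_of_nonpos (by linarith) h.le (by linarith)).trans hTε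
    have h3 : 0 ≤ T ^ M * a := by positivity
    have := mul_le_mul_of_nonneg_right h2 (Real.rpow_nonneg ha m)
    linarith

/-- The volume of the unit ball of `ℝ^N`. -/
def unitBallVolume (N : ℕ) : ℝ := (volume (Metric.ball (0 : RN N) 1)).toReal

theorem unitBallVolume_pos : 0 < unitBallVolume N :=
  ENNReal.toReal_pos (Metric.measure_ball_pos _ _ one_pos).ne' measure_ball_lt_top.ne

theorem volume_ball_eq_ofReal (x : RN N) {r : ℝ} (hr : 0 < r) :
    volume (Metric.ball x r) = ENNReal.ofReal (unitBallVolume N * r ^ (N : ℝ)) := by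
  rw [Measure.addHaar_ball_of_pos _ _ hr, finrank_euclideanSpace_fin, mul_comm,
    ENNReal.ofReal_mul unitBallVolume_pos.le, Real.rpow_natCast, unitBallVolume,
    ENNReal.ofReal_toReal measure_ball_lt_top.ne]

section Kernel

variable {s p : RN N → RN N → ℝ} {σ q₀ P c : ℝ} {u : RN N → ℝ}

theorem UniformExponents.measurable_gkernel (h : UniformExponents s p σ q₀ P c)
    (hu : Measurable u) :
    Measurable (fun z : RN N × RN N => gkernel s p u z.1 z.2) := by
  have h1 := h.continuous_s.measurable
  have h2 := h.continuous_p.measurable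
  have h3 : Measurable fun z : RN N × RN N => dist z.1 z.2 := measurable_dist
  unfold gkernel
  have h4 : Measurable fun z : RN N × RN N => |u z.1 - u z.2| := by
    have := (hu.comp measurable_fst).sub (hu.comp measurable_snd)
    exact measurable_norm.comp this
  exact (h4.ennreal_ofReal.pow h2).div (h3.ennreal_ofReal.pow ((h1.mul h2).const_add _))

theorem UniformExponents.measurable_gdensity (h : UniformExponents s p σ q₀ P c)
    (hu : Measurable u) : Measurable (gdensity s p u) :=
  (h.measurable_gkernel hu).lintegral_prod_right'

theorem UniformExponents.lintegral_gdensity (h : UniformExponents s p σ q₀ P c)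
    (hu : Measurable u) : ∫⁻ x, gdensity s p u x = gmodular univ s p u 1 := by
  have := lintegral_prod (μ := (volume : Measure (RN N))) (ν := volume) _
    (h.measurable_gkernel hu).aemeasurable
  unfold gmodular gdensity
  simp only [div_one, Measure.restrict_univ]
  rw [← this]
  rfl

theorem gkernel_of_ne {x y : RN N} (hp : 0 ≤ p x y) (hxy : x ≠ y) :
    gkernel s p u x y =
      ENNReal.ofReal (|u x - u y| ^ p x y / dist x y ^ ((N : ℝ) + s x y * p x y)) := by
  have hd : 0 < dist x y := dist_pos.2 hxy
  rw [gkernel, ENNReal.ofReal_rpow_of_nonneg (abs_nonneg _) hp, ENNReal.ofReal_rpow_of_pos hd,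
    ENNReal.ofReal_div_of_pos (Real.rpow_pos_of_pos hd _)]

theorem ofReal_abs_sub_le_gkernel {x y : RN N} {r t q l : ℝ} (hxy : dist x y ≤ r) (hr₀ : 0 < r)
    (hr : r ≤ 1) (ht : 0 ≤ t) (hts : t ≤ s x y) (hq : 1 ≤ q) (hqp : q ≤ p x y) (hl : 1 ≤ l) :
    ENNReal.ofReal |u x - u y| ≤ ENNReal.ofReal (r ^ t * l) +
      ENNReal.ofReal (r ^ t * l ^ (1 - q) * r ^ (N : ℝ)) * gkernel s p u x y := by
  have hl0 : 0 < l := by linarith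
  rcases eq_or_ne x y with rfl | hne
  · simp
  rw [gkernel_of_ne (by linarith) hne, ← ENNReal.ofReal_mul (by positivity),
    ← ENNReal.ofReal_add (by positivity) (by positivity)]
  exact ENNReal.ofReal_le_ofReal (le_add_mul_rpow_div (abs_nonneg _) (dist_pos.2 hne) hxy hr ht
    hts hq hqp hl (Nat.cast_nonneg _))

theorem setLIntegral_abs_sub_le {x : RN N} {B : Set (RN N)} (hB : MeasurableSet B)
    {r t q l : ℝ} (hr₀ : 0 < r) (hr : r ≤ 1) (ht : 0 ≤ t) (hq : 1 ≤ q) (hl : 1 ≤ l)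
    (hBx : ∀ y ∈ B, dist x y ≤ r ∧ t ≤ s x y ∧ q ≤ p x y) :
    ∫⁻ y in B, ENNReal.ofReal |u x - u y| ≤ ENNReal.ofReal (r ^ t * l) * volume B +
      ENNReal.ofReal (r ^ t * l ^ (1 - q) * r ^ (N : ℝ)) * gdensity s p u x := by
  calc ∫⁻ y in B, ENNReal.ofReal |u x - u y|
      ≤ ∫⁻ y in B, (ENNReal.ofReal (r ^ t * l) +
          ENNReal.ofReal (r ^ t * l ^ (1 - q) * r ^ (N : ℝ)) * gkernel s p u x y) :=
        setLIntegral_mono' hB fun y hy => ofReal_abs_sub_le_gkernel (hBx y hy).1 hr₀ hr ht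
          (hBx y hy).2.1 hq (hBx y hy).2.2 hl
    _ ≤ _ := by
        rw [lintegral_add_left measurable_const, setLIntegral_const,
          lintegral_const_mul' _ _ ENNReal.ofReal_ne_top]
        gcongr
        exact setLIntegral_le_lintegral _ _

end Kernel

/-- Functions vanishing outside `Ω` whose Gagliardo modular is at most one. -/
structure Admissible (Ω : Set (RN N)) (s p : RN N → RN N → ℝ) (u : RN N → ℝ) : Prop where
  measurable : Measurable u
  ae_eq_zero : ∀ᵐ x, x ∉ Ω → u x = 0
  gmodular_le : gmodular univ s p u 1 ≤ 1

section Estimates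

variable {Ω : Set (RN N)} {s p : RN N → RN N → ℝ} {σ q₀ P c : ℝ}

theorem Admissible.lintegral_gdensity_le {u : RN N → ℝ} (hu : Admissible Ω s p u)
    (h : UniformExponents s p σ q₀ P c) : ∫⁻ x, gdensity s p u x ≤ 1 :=
  (h.lintegral_gdensity hu.measurable).trans_le hu.gmodular_le

theorem Admissible.lintegral_one_add_gdensity_le {u : RN N → ℝ} (hu : Admissible Ω s p u)
    (h : UniformExponents s p σ q₀ P c) :
    ∫⁻ x in Ω, (1 + gdensity s p u x) ≤ volume Ω + 1 := by
  rw [lintegral_add_left measurable_const, setLIntegral_const, one_mul]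
  gcongr
  exact (setLIntegral_le_lintegral _ _).trans (hu.lintegral_gdensity_le h)

/-- A Poincaré inequality: admissible functions are bounded in `L¹`. -/
theorem exists_lintegral_abs_le (hN : 2 ≤ N) (hΩo : IsOpen Ω) (hΩb : Bornology.IsBounded Ω)
    (h : UniformExponents s p σ q₀ P c) :
    ∃ C : ℝ≥0∞, C ≠ ⊤ ∧ ∀ u, Admissible Ω s p u → ∫⁻ x in Ω, ENNReal.ofReal |u x| ≤ C := by
  obtain ⟨R, hR0, hR⟩ := hΩb.subset_ball_lt 0 (0 : RN N)
  obtain ⟨x₁, hx₁⟩ : ∃ x₁ : RN N, ‖x₁‖ = R + 1 := by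
    have : Nonempty (Fin N) := ⟨⟨0, by omega⟩⟩
    exact exists_norm_eq _ (by linarith)
  set A := Metric.ball x₁ 1 with hA
  set D : ℝ := 2 * R + 2 with hD
  have hD1 : 1 ≤ D := by linarith
  have hvA : 0 < volume A := Metric.measure_ball_pos _ _ one_pos
  have hvA' : volume A ≠ ⊤ := measure_ball_lt_top.ne
  have hAΩ : ∀ y ∈ A, y ∉ Ω := by
    intro y hy hyΩ
    have h1 := hR hyΩ
    rw [mem_ball_zero_iff] at h1
    have h2 : dist y x₁ < 1 := hy
    rw [dist_eq_norm] at h2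
    have := norm_sub_norm_le x₁ y
    rw [norm_sub_rev] at this
    linarith
  have hdist : ∀ x ∈ Ω, ∀ y ∈ A, dist x y ≤ D := by
    intro x hx y hy
    have h1 := hR hx
    rw [Metric.mem_ball] at h1
    have h2 : dist y x₁ < 1 := hy
    have h3 : dist x₁ 0 = R + 1 := by rw [dist_zero_right, hx₁]
    have h4 := dist_triangle4 x 0 x₁ y
    rw [dist_comm 0 x₁, dist_comm x₁ y] at h4
    linarith
  refine ⟨(volume A)⁻¹ * ((volume A + ENNReal.ofReal (D ^ (2 * (N : ℝ)))) * (volume Ω + 1)),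
    ?_, fun u hu => ?_⟩
  · exact ENNReal.mul_ne_top (ENNReal.inv_ne_top.2 hvA.ne')
      (ENNReal.mul_ne_top (ENNReal.add_ne_top.2 ⟨hvA', ENNReal.ofReal_ne_top⟩)
        (ENNReal.add_ne_top.2 ⟨hΩb.measure_lt_top.ne, ENNReal.one_ne_top⟩))
  have key : ∀ x ∈ Ω, ENNReal.ofReal |u x| ≤
      (volume A)⁻¹ * ((volume A + ENNReal.ofReal (D ^ (2 * (N : ℝ)))) *
        (1 + gdensity s p u x)) := by
    intro x hx
    have h1 : ∀ᵐ y ∂(volume.restrict A), ENNReal.ofReal |u x| ≤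
        1 + ENNReal.ofReal (D ^ (2 * (N : ℝ))) * gkernel s p u x y := by
      rw [ae_restrict_iff' Metric.isOpen_ball.measurableSet]
      filter_upwards [hu.ae_eq_zero] with y hy hyA
      have hu0 := hy (hAΩ y hyA)
      have hne : x ≠ y := fun e => hAΩ y hyA (e ▸ hx)
      have hd : 0 < dist x y := dist_pos.2 hne
      have hp1 : 1 ≤ p x y := h.one_lt.le.trans (h.exponent_ge x y)
      rw [gkernel_of_ne (by linarith) hne, ← ENNReal.ofReal_mul (by positivity),
        ← ENNReal.ofReal_one, ← ENNReal.ofReal_add zero_le_one (by positivity), hu0, sub_zero]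
      refine ENNReal.ofReal_le_ofReal ?_
      have h2 := rpow_le_one_add_rpow (abs_nonneg (u x)) zero_le_one hp1
      rw [Real.rpow_one] at h2
      have h3 : dist x y ^ ((N : ℝ) + s x y * p x y) ≤ D ^ (2 * (N : ℝ)) := by
        have h4 := h.mul_le x y
        have h5 := h.pos_gap
        have h6 : 0 ≤ s x y := h.pos_order.le.trans (h.order_ge x y)
        have h7 : 0 ≤ s x y * p x y := by positivity
        calc dist x y ^ ((N : ℝ) + s x y * p x y) ≤ D ^ ((N : ℝ) + s x y * p x y) :=
              Real.rpow_le_rpow hd.le (hdist x hx y hyA) (by positivity)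
          _ ≤ _ := Real.rpow_le_rpow_of_exponent_le hD1 (by linarith)
      have h8 : |u x| ^ p x y ≤ D ^ (2 * (N : ℝ)) *
          (|u x| ^ p x y / dist x y ^ ((N : ℝ) + s x y * p x y)) := by
        rw [mul_div_assoc', le_div_iff₀ (Real.rpow_pos_of_pos hd _), mul_comm]
        gcongr
      linarith
    have h2 : ENNReal.ofReal |u x| * volume A ≤
        volume A + ENNReal.ofReal (D ^ (2 * (N : ℝ))) * gdensity s p u x := by
      calc ENNReal.ofReal |u x| * volume A = ∫⁻ y in A, ENNReal.ofReal |u x| := by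
            rw [setLIntegral_const]
        _ ≤ ∫⁻ y in A, (1 + ENNReal.ofReal (D ^ (2 * (N : ℝ))) * gkernel s p u x y) :=
            lintegral_mono_ae h1
        _ ≤ _ := by
            rw [lintegral_add_left measurable_const, setLIntegral_const, one_mul,
              lintegral_const_mul' _ _ ENNReal.ofReal_ne_top]
            gcongr
            exact setLIntegral_le_lintegral _ _
    calc ENNReal.ofReal |u x| = (volume A)⁻¹ * (ENNReal.ofReal |u x| * volume A) := by
          rw [mul_comm (ENNReal.ofReal |u x|), ← mul_assoc, ENNReal.inv_mul_cancel hvA.ne' hvA',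
            one_mul]
      _ ≤ _ := by
          refine mul_le_mul' le_rfl (h2.trans ?_)
          rw [add_mul, mul_add, mul_add, mul_one, mul_one]
          gcongr
          · exact le_self_add
          · exact le_add_self
  calc ∫⁻ x in Ω, ENNReal.ofReal |u x|
      ≤ ∫⁻ x in Ω, (volume A)⁻¹ * ((volume A + ENNReal.ofReal (D ^ (2 * (N : ℝ)))) *
        (1 + gdensity s p u x)) := setLIntegral_mono' hΩo.measurableSet key
    _ = (volume A)⁻¹ * ((volume A + ENNReal.ofReal (D ^ (2 * (N : ℝ)))) *
        ∫⁻ x in Ω, (1 + gdensity s p u x)) := by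
        rw [lintegral_const_mul' _ _ (ENNReal.inv_ne_top.2 hvA.ne'),
          lintegral_const_mul' _ _ (ENNReal.add_ne_top.2 ⟨hvA', ENNReal.ofReal_ne_top⟩)]
    _ ≤ _ := by
        gcongr
        exact hu.lintegral_one_add_gdensity_le h

theorem le_mul_rpow_of_average_le {U ω r₀ r t l q g μ m₁ m' C n : ℝ} (hω : 0 < ω)
    (hr₀ : 0 < r₀) (hr₀' : r₀ ≤ 1) (ht : 0 ≤ t) (hq : 1 ≤ q) (hg : 0 ≤ g) (hm' : 1 ≤ m')
    (hn : 0 < n) (hmm : m' ≤ q * (1 + t * m₁ / n))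
    (hl : l = (1 + g) ^ (1 / q)) (hμ : μ = (1 + g) ^ (1 / m'))
    (hr : r = r₀ * (1 + g) ^ (-(m₁ / (n * m'))))
    (hU : U * (ω * r ^ n) ≤ r ^ t * l * (ω * r ^ n) + r ^ t * l ^ (1 - q) * r ^ n * g +
      (μ * (ω * r ^ n) + μ ^ (1 - m₁) * C)) :
    U ≤ (2 + 1 / ω + C / (ω * r₀ ^ n)) * μ := by
  have hG : 1 ≤ 1 + g := by linarith
  have hG0 : 0 < 1 + g := by linarith
  have hr0 : 0 < r := by rw [hr]; positivity
  have hl0 : 0 < l := by rw [hl]; positivity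
  have hμ0 : 0 < μ := by rw [hμ]; positivity
  have hrn : 0 < r ^ n := Real.rpow_pos_of_pos hr0 n
  have hrt : r ^ t * l ≤ μ := by
    have h1 : r ^ t ≤ (1 + g) ^ (-(m₁ / (n * m')) * t) := by
      rw [hr, Real.mul_rpow hr₀.le (by positivity), ← Real.rpow_mul hG0.le]
      have := Real.rpow_le_one hr₀.le hr₀' ht
      have h2 : 0 < (1 + g) ^ (-(m₁ / (n * m')) * t) := by positivity
      nlinarith
    calc r ^ t * l ≤ (1 + g) ^ (-(m₁ / (n * m')) * t) * l := by gcongr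
      _ = (1 + g) ^ (-(m₁ / (n * m')) * t + 1 / q) := by rw [hl, ← Real.rpow_add hG0]
      _ ≤ μ := by
        rw [hμ]
        refine Real.rpow_le_rpow_of_exponent_le hG ?_
        have h3 : 1 / q ≤ (1 + t * m₁ / n) / m' := by
          rw [div_le_div_iff₀ (by linarith) (by linarith)]
          linarith
        have h4 : (1 + t * m₁ / n) / m' = 1 / m' + m₁ / (n * m') * t := by
          field_simp
        linarith
  have hlg : l ^ (1 - q) * g ≤ l := by
    have h1 : l ^ (1 - q) = l * (1 + g)⁻¹ := by
      rw [sub_eq_add_neg, Real.rpow_add hl0, Real.rpow_one, Real.rpow_neg hl0.le]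
      congr 2
      rw [hl, ← Real.rpow_mul hG0.le, one_div_mul_cancel (by linarith), Real.rpow_one]
    rw [h1, mul_assoc]
    have : (1 + g)⁻¹ * g ≤ 1 := by
      rw [inv_mul_le_iff₀ hG0]; linarith
    nlinarith
  have hμm : μ ^ (1 - m₁) = μ * (r ^ n / r₀ ^ n) := by
    have h1 : r ^ n / r₀ ^ n = (1 + g) ^ (-(m₁ / (n * m')) * n) := by
      rw [hr, Real.mul_rpow hr₀.le (by positivity), ← Real.rpow_mul hG0.le]
      field_simp
    rw [h1, hμ, ← Real.rpow_mul hG0.le, ← Real.rpow_add hG0]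
    congr 1
    field_simp
    ring
  have h5 : r ^ t * l ^ (1 - q) * r ^ n * g ≤ μ * r ^ n := by
    have h6 : r ^ t * (l ^ (1 - q) * g) ≤ r ^ t * l := by gcongr
    calc r ^ t * l ^ (1 - q) * r ^ n * g = r ^ t * (l ^ (1 - q) * g) * r ^ n := by ring
      _ ≤ μ * r ^ n := by
        have := h6.trans hrt
        gcongr
  have h7 : r ^ t * l * (ω * r ^ n) ≤ μ * (ω * r ^ n) := by gcongr
  have h8 : U * (ω * r ^ n) ≤ (2 + 1 / ω + C / (ω * r₀ ^ n)) * μ * (ω * r ^ n) := by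
    have h9 : (2 + 1 / ω + C / (ω * r₀ ^ n)) * μ * (ω * r ^ n) =
        2 * (μ * (ω * r ^ n)) + μ * r ^ n + μ * (r ^ n / r₀ ^ n) * C := by
      field_simp
    rw [h9, ← hμm]
    linarith
  exact le_of_mul_le_mul_right h8 (by positivity)

/-- Hedberg-type pointwise bound improving the integrability exponent `m` to `m'`. -/
theorem ofReal_abs_rpow_le (hN : 0 < N) {u : RN N → ℝ}
    (hum : Measurable u) {m : RN N → ℝ} (hm : ∀ y, 1 ≤ m y) {x : RN N}
    {r₀ t q m₁ m' C M : ℝ} (hr₀ : 0 < r₀) (hr₀' : r₀ ≤ 1) (ht : 0 ≤ t) (hq : 1 ≤ q)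
    (hm₁ : 0 ≤ m₁) (hm' : 1 ≤ m') (hM : m' ≤ M) (hC : 0 ≤ C)
    (hball : ∀ y ∈ Metric.ball x r₀, q ≤ p x y ∧ t ≤ s x y ∧ m₁ ≤ m y)
    (hmm : m' ≤ q * (1 + t * m₁ / N))
    (hu : ∫⁻ y, ENNReal.ofReal |u y| ^ m y ≤ ENNReal.ofReal C) :
    ENNReal.ofReal |u x| ^ m' ≤
      ENNReal.ofReal ((2 + 1 / unitBallVolume N + C / (unitBallVolume N * r₀ ^ (N : ℝ))) ^ M) *
        (1 + gdensity s p u x) := by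
  have hω := unitBallVolume_pos (N := N)
  set ω := unitBallVolume N
  set K := 2 + 1 / ω + C / (ω * r₀ ^ (N : ℝ)) with hK
  have hK1 : 1 ≤ K := by
    have : 0 ≤ 1 / ω + C / (ω * r₀ ^ (N : ℝ)) := by positivity
    linarith
  have hn : (0 : ℝ) < N := by exact_mod_cast hN
  rcases eq_or_ne (gdensity s p u x) ⊤ with hG | hG
  · rw [hG, add_top, ENNReal.mul_top]
    · exact le_top
    · exact (ENNReal.ofReal_pos.2 (by positivity)).ne'
  set g := (gdensity s p u x).toReal with hg
  have hg0 : 0 ≤ g := ENNReal.toReal_nonneg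
  have hGg : gdensity s p u x = ENNReal.ofReal g := (ENNReal.ofReal_toReal hG).symm
  have hG1 : 1 ≤ 1 + g := by linarith
  have hG0 : 0 < 1 + g := by linarith
  obtain ⟨l, hl⟩ : ∃ l, l = (1 + g) ^ (1 / q) := ⟨_, rfl⟩
  obtain ⟨μ, hμ⟩ : ∃ μ, μ = (1 + g) ^ (1 / m') := ⟨_, rfl⟩
  obtain ⟨r, hr⟩ : ∃ r, r = r₀ * (1 + g) ^ (-(m₁ / (N * m'))) := ⟨_, rfl⟩
  have hr0 : 0 < r := by rw [hr]; positivity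
  have hl1 : 1 ≤ l := by rw [hl]; exact Real.one_le_rpow hG1 (by positivity)
  have hμ1 : 1 ≤ μ := by rw [hμ]; exact Real.one_le_rpow hG1 (by positivity)
  have hμ0 : 0 < μ := by linarith
  have hl0 : 0 < l := by linarith
  have hrr : r ≤ r₀ := by
    rw [hr]
    have : (1 + g) ^ (-(m₁ / (N * m'))) ≤ 1 :=
      Real.rpow_le_one_of_one_le_of_nonpos hG1 (neg_nonpos.2 (by positivity))
    nlinarith
  have hsub : Metric.ball x r ⊆ Metric.ball x r₀ := Metric.ball_subset_ball hrr
  have hvol := volume_ball_eq_ofReal x hr0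
  have hB : MeasurableSet (Metric.ball x r) := Metric.isOpen_ball.measurableSet
  have e1 := setLIntegral_abs_sub_le (s := s) (p := p) (u := u) (x := x) hB hr0
    (hrr.trans hr₀') ht hq hl1
    (fun y hy => ⟨by rw [dist_comm]; exact (Metric.mem_ball.1 hy).le,
      (hball y (hsub hy)).2.1, (hball y (hsub hy)).1⟩)
  have e2 : ∫⁻ y in Metric.ball x r, ENNReal.ofReal |u y| ≤
      ENNReal.ofReal μ * volume (Metric.ball x r) +
        ENNReal.ofReal (μ ^ (1 - m₁)) * ENNReal.ofReal C := by
    calc ∫⁻ y in Metric.ball x r, ENNReal.ofReal |u y|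
        ≤ ∫⁻ y in Metric.ball x r, (ENNReal.ofReal μ +
            ENNReal.ofReal (μ ^ (1 - m₁)) * ENNReal.ofReal |u y| ^ m y) := by
          refine setLIntegral_mono' hB fun y hy => ?_
          rw [ENNReal.ofReal_rpow_of_nonneg (abs_nonneg _) (by linarith [hm y]),
            ← ENNReal.ofReal_mul (by positivity),
            ← ENNReal.ofReal_add (by positivity) (by positivity)]
          exact ENNReal.ofReal_le_ofReal
            (le_add_mul_rpow (abs_nonneg _) hμ1 (hm y) (hball y (hsub hy)).2.2)
      _ ≤ _ := by
          rw [lintegral_add_left measurable_const, setLIntegral_const,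
            lintegral_const_mul' _ _ ENNReal.ofReal_ne_top]
          gcongr
          exact (setLIntegral_le_lintegral _ _).trans hu
  have e3 : ENNReal.ofReal |u x| * volume (Metric.ball x r) ≤
      (∫⁻ y in Metric.ball x r, ENNReal.ofReal |u x - u y|) +
        ∫⁻ y in Metric.ball x r, ENNReal.ofReal |u y| := by
    have hmeas : Measurable fun y => ENNReal.ofReal |u y| :=
      (measurable_norm.comp hum).ennreal_ofReal
    rw [← setLIntegral_const, ← lintegral_add_right _ hmeas]
    refine lintegral_mono fun y => ?_
    rw [← ENNReal.ofReal_add (abs_nonneg _) (abs_nonneg _)]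
    refine ENNReal.ofReal_le_ofReal ?_
    simpa using abs_add_le (u x - u y) (u y)
  have e4 := e3.trans (add_le_add e1 e2)
  rw [hvol, hGg] at e4
  rw [← ENNReal.ofReal_mul (by positivity), ← ENNReal.ofReal_mul (by positivity),
    ← ENNReal.ofReal_mul (by positivity), ← ENNReal.ofReal_mul (by positivity),
    ← ENNReal.ofReal_mul (by positivity), ← ENNReal.ofReal_add (by positivity) (by positivity),
    ← ENNReal.ofReal_add (by positivity) (by positivity),
    ← ENNReal.ofReal_add (by positivity) (by positivity),
    ENNReal.ofReal_le_ofReal_iff (by positivity)] at e4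
  have e5 := le_mul_rpow_of_average_le hω hr₀ hr₀' ht hq hg0 hm' hn hmm hl hμ hr e4
  rw [hGg, ← ENNReal.ofReal_one, ← ENNReal.ofReal_add zero_le_one hg0,
    ENNReal.ofReal_rpow_of_nonneg (abs_nonneg _) (by linarith),
    ← ENNReal.ofReal_mul (by positivity)]
  refine ENNReal.ofReal_le_ofReal ?_
  calc |u x| ^ m' ≤ (K * μ) ^ m' := by gcongr
    _ = K ^ m' * (1 + g) := by
        rw [Real.mul_rpow (by positivity) hμ0.le]
        congr 1
        rw [hμ, ← Real.rpow_mul hG0.le, one_div_mul_cancel (by linarith), Real.rpow_one]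
    _ ≤ K ^ M * (1 + g) := by
        have := Real.rpow_le_rpow_of_exponent_le hK1 hM
        gcongr

/-- One step of the integrability bootstrap. -/
theorem exists_lintegral_rpow_le_of_exponent_gain (h : UniformExponents s p σ q₀ P c)
    (hN : 0 < N) (hΩo : IsOpen Ω) (hΩb : Bornology.IsBounded Ω) {m m' : RN N → ℝ}
    (hm : ∀ y, 1 ≤ m y) {r₀ M : ℝ} (hr₀ : 0 < r₀) (hr₀' : r₀ ≤ 1)
    (hm' : ∀ x ∈ Ω, 1 ≤ m' x ∧ m' x ≤ M)
    (hgain : ∀ x ∈ Ω, ∃ q t m₁ : ℝ, 1 ≤ q ∧ 0 ≤ t ∧ 0 ≤ m₁ ∧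
      (∀ y ∈ Metric.ball x r₀, q ≤ p x y ∧ t ≤ s x y ∧ m₁ ≤ m y) ∧
      m' x ≤ q * (1 + t * m₁ / N)) {C : ℝ≥0∞} (hC : C ≠ ⊤) :
    ∃ C' : ℝ≥0∞, C' ≠ ⊤ ∧ ∀ u, Admissible Ω s p u →
      ∫⁻ x in Ω, ENNReal.ofReal |u x| ^ m x ≤ C →
      ∫⁻ x in Ω, ENNReal.ofReal |u x| ^ m' x ≤ C' := by
  refine ⟨ENNReal.ofReal ((2 + 1 / unitBallVolume N +
      C.toReal / (unitBallVolume N * r₀ ^ (N : ℝ))) ^ M) * (volume Ω + 1),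
    ENNReal.mul_ne_top ENNReal.ofReal_ne_top
      (ENNReal.add_ne_top.2 ⟨hΩb.measure_lt_top.ne, ENNReal.one_ne_top⟩), fun u hu huC => ?_⟩
  have hwhole : ∫⁻ y, ENNReal.ofReal |u y| ^ m y ≤ ENNReal.ofReal C.toReal := by
    rw [ENNReal.ofReal_toReal hC]
    refine le_trans (le_of_eq ?_) huC
    rw [← lintegral_indicator hΩo.measurableSet]
    refine lintegral_congr_ae ?_
    filter_upwards [hu.ae_eq_zero] with y hy
    by_cases hyΩ : y ∈ Ω
    · rw [indicator_of_mem hyΩ]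
    · rw [indicator_of_notMem hyΩ, hy hyΩ, abs_zero, ENNReal.ofReal_zero,
        ENNReal.zero_rpow_of_pos (by linarith [hm y])]
  calc ∫⁻ x in Ω, ENNReal.ofReal |u x| ^ m' x
      ≤ ∫⁻ x in Ω, ENNReal.ofReal ((2 + 1 / unitBallVolume N +
          C.toReal / (unitBallVolume N * r₀ ^ (N : ℝ))) ^ M) * (1 + gdensity s p u x) := by
        refine setLIntegral_mono' hΩo.measurableSet fun x hx => ?_
        obtain ⟨q, t, m₁, hq, ht, hm₁, hball, hmm⟩ := hgain x hx
        exact ofReal_abs_rpow_le hN hu.measurable hm hr₀ hr₀' ht hq hm₁ (hm' x hx).1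
          (hm' x hx).2 ENNReal.toReal_nonneg hball hmm hwhole
    _ ≤ _ := by
        rw [lintegral_const_mul' _ _ ENNReal.ofReal_ne_top]
        gcongr
        exact hu.lintegral_one_add_gdensity_le h

theorem UniformExponents.pstar_bounds (h : UniformExponents s p σ q₀ P c) (x : RN N) :
    p x x ≤ pstar s p x ∧ pstar s p x ≤ N * P / c ∧
      pstar s p x * (N - s x x * p x x) = N * p x x := by
  have h1 := h.mul_le x x
  have h2 := h.pos_gap
  have h3 : 0 < s x x := h.pos_order.trans_le (h.order_ge x x)
  have h4 : 1 < p x x := h.one_lt.trans_le (h.exponent_ge x x)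
  have h5 : 0 < (N : ℝ) - s x x * p x x := by linarith
  have h6 : 0 ≤ s x x * p x x := by positivity
  refine ⟨?_, ?_, ?_⟩
  · rw [pstar, le_div_iff₀ h5]
    nlinarith
  · rw [pstar]
    have := h.exponent_le x x
    have : 0 ≤ (N : ℝ) * P := mul_nonneg (Nat.cast_nonneg _) (by linarith)
    gcongr
    linarith
  · rw [pstar, div_mul_cancel₀ _ h5.ne']

theorem UniformExponents.continuous_pstar (h : UniformExponents s p σ q₀ P c) :
    Continuous (pstar s p) := by
  have hd : Continuous fun x : RN N => (x, x) := by fun_prop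
  have h1 := h.continuous_s.comp hd
  have h2 := h.continuous_p.comp hd
  refine (continuous_const.mul h2).div (continuous_const.sub (h1.mul h2)) fun x => ?_
  have h3 := h.mul_le x x
  have h4 := h.pos_gap
  exact (show 0 < (N : ℝ) - s x x * p x x by linarith).ne'

theorem exists_forall_ball_abs_sub_lt {f : RN N × RN N → ℝ} (hf : Continuous f)
    (hΩb : Bornology.IsBounded Ω) {δ : ℝ} (hδ : 0 < δ) :
    ∃ r, 0 < r ∧ ∀ x ∈ Ω, ∀ y ∈ Metric.ball x r, |f (x, y) - f (x, x)| < δ := by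
  obtain ⟨R, hR⟩ := hΩb.subset_closedBall (0 : RN N)
  have hK : IsCompact (Metric.closedBall (0 : RN N) (R + 1) ×ˢ
      Metric.closedBall (0 : RN N) (R + 1)) :=
    (isCompact_closedBall _ _).prod (isCompact_closedBall _ _)
  have huc := hK.uniformContinuousOn_of_continuous hf.continuousOn
  rw [Metric.uniformContinuousOn_iff] at huc
  obtain ⟨r, hr, hr'⟩ := huc δ hδ
  refine ⟨min r 1, lt_min hr one_pos, fun x hx y hy => ?_⟩
  have h1 : dist y x < min r 1 := hy
  have h2 := hR hx
  rw [Metric.mem_closedBall] at h2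
  have h3 := dist_triangle y x 0
  have h4 := min_le_right r 1
  have hx' : x ∈ Metric.closedBall (0 : RN N) (R + 1) := by
    rw [Metric.mem_closedBall]; linarith
  have hy' : y ∈ Metric.closedBall (0 : RN N) (R + 1) := by
    rw [Metric.mem_closedBall]; linarith
  have h5 := hr' (x, y) ⟨hx', hy'⟩ (x, x) ⟨hx', hx'⟩ (by
    rw [dist_prod_same_left]; exact h1.trans_le (min_le_left _ _))
  rwa [Real.dist_eq] at h5

/-- Exponents interpolating between `1` and the critical exponent. -/
def interpExponent (s p : RN N → RN N → ℝ) (θ : ℝ) (x : RN N) : ℝ :=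
  1 + θ * (pstar s p x - 1)

theorem exists_interpExponent_gain (h : UniformExponents s p σ q₀ P c) (hN : 0 < N)
    (hΩb : Bornology.IsBounded Ω) {θ κ : ℝ} (hθ : 0 ≤ θ) (hθ' : θ < 1) (hκ₀ : 0 ≤ κ)
    (hκ : κ * (N * P / c) ≤ (q₀ - 1) / 2) :
    ∃ r₀, 0 < r₀ ∧ r₀ ≤ 1 ∧ ∀ x ∈ Ω, ∃ q t m₁ : ℝ, 1 ≤ q ∧ 0 ≤ t ∧ 0 ≤ m₁ ∧
      (∀ y ∈ Metric.ball x r₀, q ≤ p x y ∧ t ≤ s x y ∧ m₁ ≤ interpExponent s p θ y) ∧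
      interpExponent s p (θ + (1 - θ) * κ) x ≤ q * (1 + t * m₁ / N) := by
  have hq₀ := h.one_lt
  have hσ := h.pos_order
  have hN1 : (1 : ℝ) ≤ N := by exact_mod_cast hN
  have hP1 : 1 < P := hq₀.trans_le ((h.exponent_ge 0 0).trans (h.exponent_le 0 0))
  set M := N * P / c with hM
  have hM0 : 0 < M := by have := h.pos_gap; positivity
  set ε := (1 - θ) * ((q₀ - 1) / 2) with hε
  have hε0 : 0 < ε := mul_pos (by linarith) (by linarith)
  set A := (1 + P) * (1 + M) with hA
  have hA0 : 0 < A := by positivity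
  obtain ⟨δ, hδ, hδ1⟩ : ∃ δ, 0 < δ ∧ δ ≤ min (min (q₀ - 1) σ) (min 1 (ε / A)) :=
    ⟨_, lt_min (lt_min (by linarith) hσ) (lt_min one_pos (by positivity)), le_rfl⟩
  simp only [le_min_iff] at hδ1
  obtain ⟨⟨hδq, hδσ⟩, hδ1, hδε⟩ := hδ1
  rw [le_div_iff₀ hA0] at hδε
  obtain ⟨r₁, hr₁, h₁⟩ := exists_forall_ball_abs_sub_lt h.continuous_p hΩb hδ
  obtain ⟨r₂, hr₂, h₂⟩ := exists_forall_ball_abs_sub_lt h.continuous_s hΩb hδ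
  have hmc : Continuous fun z : RN N × RN N => interpExponent s p θ z.2 := by
    have := h.continuous_pstar.comp (continuous_snd (X := RN N) (Y := RN N))
    exact continuous_const.add (continuous_const.mul (this.sub continuous_const))
  obtain ⟨r₃, hr₃, h₃⟩ := exists_forall_ball_abs_sub_lt hmc hΩb hδ
  refine ⟨min (min r₁ r₂) (min r₃ 1), by positivity, (min_le_right _ _).trans (min_le_right _ _),
    fun x hx => ⟨p x x - δ, s x x - δ, interpExponent s p θ x - δ, ?_⟩⟩
  obtain ⟨b1, b2, b3⟩ := h.pstar_bounds x
  have hp1 := h.exponent_ge x x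
  have hp2 := h.exponent_le x x
  have hs1 := h.order_ge x x
  have hs2 := h.order_le x x
  have hm1 : 1 ≤ interpExponent s p θ x := by
    have : 0 ≤ θ * (pstar s p x - 1) := mul_nonneg hθ (by linarith)
    unfold interpExponent; linarith
  have hm2 : interpExponent s p θ x ≤ M := by
    have : θ * (pstar s p x - 1) ≤ 1 * (pstar s p x - 1) := by
      gcongr
      linarith
    unfold interpExponent; linarith
  refine ⟨by linarith, by linarith, by linarith, fun y hy => ?_, ?_⟩
  · have hy1 := h₁ x hx y (Metric.ball_subset_ball ((min_le_left _ _).trans (min_le_left _ _)) hy)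
    have hy2 := h₂ x hx y (Metric.ball_subset_ball ((min_le_left _ _).trans (min_le_right _ _)) hy)
    have hy3 := h₃ x hx y (Metric.ball_subset_ball ((min_le_right _ _).trans (min_le_left _ _)) hy)
    rw [abs_lt] at hy1 hy2 hy3
    simp only at hy1 hy2 hy3
    exact ⟨by linarith, by linarith, by linarith⟩
  · have g1 : interpExponent s p (θ + (1 - θ) * κ) x ≤ interpExponent s p θ x + ε := by
      have k1 : κ * (pstar s p x - 1) ≤ (q₀ - 1) / 2 := by nlinarith
      have k2 := mul_le_mul_of_nonneg_left k1 (by linarith : 0 ≤ 1 - θ)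
      unfold interpExponent
      rw [hε]
      linarith
    have g2 : interpExponent s p θ x + 2 * ε ≤
        p x x * (1 + s x x * interpExponent s p θ x / N) := by
      have k1 : p x x * (s x x * pstar s p x / N) = pstar s p x - p x x := by
        field_simp
        linarith
      have k2 : 0 ≤ p x x * (s x x / N) := by
        have : 0 ≤ p x x := by linarith
        have : 0 ≤ s x x := by linarith
        positivity
      have k3 : p x x * (1 + s x x * interpExponent s p θ x / N) =
          p x x + θ * (p x x * (s x x * pstar s p x / N)) + (1 - θ) * (p x x * (s x x / N)) := by
        unfold interpExponent; ring
      rw [k3, k1, hε]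
      unfold interpExponent
      have k4 := mul_nonneg (by linarith : 0 ≤ 1 - θ) k2
      have k5 := mul_le_mul_of_nonneg_left hp1 (by linarith : 0 ≤ 1 - θ)
      linarith
    set m := interpExponent s p θ x
    have g3 : p x x * (1 + s x x * m / N) - ε ≤
        (p x x - δ) * (1 + (s x x - δ) * (m - δ) / N) := by
      have k1 : (p x x - δ) * (1 + (s x x - δ) * (m - δ) / N) =
          p x x * (1 + s x x * m / N) - δ * (1 + (s x x * m) / N)
          - (p x x - δ) * δ * ((s x x + m - δ) / N) := by ring
      have k2 : s x x * m / N ≤ M := by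
        rw [div_le_iff₀ (by linarith)]
        nlinarith
      have k3 : (s x x + m - δ) / N ≤ 1 + M := by
        rw [div_le_iff₀ (by linarith)]
        nlinarith
      have k4 : 0 ≤ (s x x + m - δ) / N := div_nonneg (by linarith) (by linarith)
      have k5 : (p x x - δ) * ((s x x + m - δ) / N) ≤ P * (1 + M) :=
        mul_le_mul (by linarith) k3 k4 (by linarith)
      rw [k1]
      have k6 := mul_le_mul_of_nonneg_left k5 hδ.le
      have k7 := mul_le_mul_of_nonneg_left k2 hδ.le
      rw [hA] at hδε
      linarith
    linarith

theorem exists_lintegral_rpow_interpExponent_le (hN : 2 ≤ N) (hΩo : IsOpen Ω)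
    (hΩb : Bornology.IsBounded Ω) (h : UniformExponents s p σ q₀ P c) {κ : ℝ} (hκ₀ : 0 ≤ κ)
    (hκ₁ : κ < 1) (hκ : κ * (N * P / c) ≤ (q₀ - 1) / 2) (n : ℕ) :
    ∃ C : ℝ≥0∞, C ≠ ⊤ ∧ ∀ u, Admissible Ω s p u →
      ∫⁻ x in Ω, ENNReal.ofReal |u x| ^ interpExponent s p (1 - (1 - κ) ^ n) x ≤ C := by
  have hge : ∀ θ : ℝ, 0 ≤ θ → ∀ x, 1 ≤ interpExponent s p θ x := by
    intro θ hθ x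
    have h1 := (h.pstar_bounds x).1
    have h2 := h.exponent_ge x x
    have h3 := h.one_lt
    have : 0 ≤ θ * (pstar s p x - 1) := mul_nonneg hθ (by linarith)
    unfold interpExponent; linarith
  have hle : ∀ θ : ℝ, θ ≤ 1 → ∀ x, interpExponent s p θ x ≤ N * P / c := by
    intro θ hθ x
    obtain ⟨h1, h4, -⟩ := h.pstar_bounds x
    have h2 := h.exponent_ge x x
    have h3 := h.one_lt
    have : θ * (pstar s p x - 1) ≤ 1 * (pstar s p x - 1) := by
      gcongr
      linarith
    unfold interpExponent; linarith
  have hpow : ∀ n : ℕ, 0 < (1 - κ) ^ n ∧ (1 - κ) ^ n ≤ 1 := fun n =>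
    ⟨pow_pos (by linarith) n, pow_le_one₀ (by linarith) (by linarith)⟩
  induction n with
  | zero =>
    obtain ⟨C, hC, hC'⟩ := exists_lintegral_abs_le hN hΩo hΩb h
    exact ⟨C, hC, fun u hu => by simpa [interpExponent] using hC' u hu⟩
  | succ n ih =>
    obtain ⟨C, hC, hC'⟩ := ih
    have hθ0 : 0 ≤ 1 - (1 - κ) ^ n := by linarith [(hpow n).2]
    obtain ⟨r₀, hr₀, hr₀', hgain⟩ := exists_interpExponent_gain h (by omega : 0 < N) hΩb hθ0
      (by linarith [(hpow n).1]) hκ₀ hκ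
    have e : 1 - (1 - κ) ^ n + (1 - (1 - (1 - κ) ^ n)) * κ = 1 - (1 - κ) ^ (n + 1) := by ring
    rw [e] at hgain
    obtain ⟨C₂, hC₂, hC₂'⟩ := exists_lintegral_rpow_le_of_exponent_gain h (by omega : 0 < N) hΩo
      hΩb (hge _ hθ0) hr₀ hr₀'
      (fun x _ => ⟨hge _ (by linarith [(hpow (n + 1)).2]) x,
        hle _ (by linarith [(hpow (n + 1)).1]) x⟩) hgain hC
    exact ⟨C₂, hC₂, fun u hu => hC₂' u hu (hC' u hu)⟩

/-- Admissible functions are bounded with respect to an exponent strictly above any given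
subcritical exponent. -/
theorem exists_supercritical_bound (hN : 2 ≤ N) (hΩo : IsOpen Ω)
    (hΩb : Bornology.IsBounded Ω) (h : UniformExponents s p σ q₀ P c) {γ : RN N → ℝ}
    (hγ : ContinuousOn γ (closure Ω)) (hγ' : ∀ x ∈ closure Ω, γ x < pstar s p x) :
    ∃ (m : RN N → ℝ) (ε M : ℝ) (C : ℝ≥0∞), Measurable m ∧ 0 < ε ∧ C ≠ ⊤ ∧
      (∀ x ∈ Ω, γ x + ε ≤ m x) ∧ (∀ x, 1 ≤ m x) ∧ (∀ x, m x ≤ M) ∧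
      ∀ u, Admissible Ω s p u → ∫⁻ x in Ω, ENNReal.ofReal |u x| ^ m x ≤ C := by
  have hq₀ := h.one_lt
  have hP : q₀ ≤ P := (h.exponent_ge 0 0).trans (h.exponent_le 0 0)
  set M := N * P / c with hM
  have hM1 : q₀ ≤ M := (h.exponent_ge 0 0).trans
    ((h.pstar_bounds 0).1.trans (h.pstar_bounds 0).2.1)
  have hM0 : 0 < M := by linarith
  obtain ⟨e, he, he'⟩ := hΩb.isCompact_closure.exists_forall_le'
    (h.continuous_pstar.continuousOn.sub hγ) (a := 0)
    (fun x hx => by simpa using hγ' x hx)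
  obtain ⟨κ, hκ⟩ : ∃ κ, κ = (q₀ - 1) / (2 * M) := ⟨_, rfl⟩
  have hκ0 : 0 < κ := by rw [hκ]; exact div_pos (by linarith) (by linarith)
  have hκ1 : κ < 1 := by rw [hκ, div_lt_one (by linarith)]; linarith
  have hκM : κ * M ≤ (q₀ - 1) / 2 := by
    rw [hκ]; apply le_of_eq; field_simp
  obtain ⟨n, hn⟩ := exists_pow_lt_of_lt_one (show 0 < e / (2 * M) by positivity)
    (show 1 - κ < 1 by linarith)
  rw [lt_div_iff₀ (by positivity)] at hn
  obtain ⟨C, hC, hC'⟩ := exists_lintegral_rpow_interpExponent_le hN hΩo hΩb h hκ0.le hκ1 hκM n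
  have hpow : 0 < (1 - κ) ^ n ∧ (1 - κ) ^ n ≤ 1 :=
    ⟨pow_pos (by linarith) n, pow_le_one₀ (by linarith) (by linarith)⟩
  have hps : ∀ x, 1 ≤ pstar s p x ∧ pstar s p x ≤ M := fun x =>
    ⟨by linarith [(h.pstar_bounds x).1, h.exponent_ge x x], (h.pstar_bounds x).2.1⟩
  refine ⟨interpExponent s p (1 - (1 - κ) ^ n), e / 2, M, C, ?_, by positivity, hC,
    fun x hx => ?_, fun x => ?_, fun x => ?_, hC'⟩
  · exact ((h.continuous_pstar.measurable.sub_const 1).const_mul _).const_add 1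
  · have h1 := he' x (subset_closure hx)
    simp only [Pi.sub_apply] at h1
    have h2 : (1 - κ) ^ n * (pstar s p x - 1) ≤ (1 - κ) ^ n * M := by
      have := (hps x).2
      have := hpow.1
      gcongr
      linarith
    unfold interpExponent
    linarith
  · have := mul_nonneg (by linarith : 0 ≤ 1 - (1 - κ) ^ n) (by linarith [(hps x).1] :
      0 ≤ pstar s p x - 1)
    unfold interpExponent
    linarith
  · have := mul_nonneg hpow.1.le (by linarith [(hps x).1] : 0 ≤ pstar s p x - 1)
    unfold interpExponent
    linarith [(hps x).2]

theorem gmodular_eq_gmodular_div {u : RN N → ℝ} {l : ℝ} (hl : 0 < l) :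
    gmodular univ s p u l = gmodular univ s p (fun x => u x / l) 1 := by
  unfold gmodular
  simp only [div_one, ← sub_div, abs_div, abs_of_pos hl]

theorem gmodular_univ_eq_Qset (hΩo : IsOpen Ω) (h : UniformExponents s p σ q₀ P c)
    {u : RN N → ℝ} (hu : ∀ᵐ x, x ∉ Ω → u x = 0) (l : ℝ) :
    gmodular univ s p u l = gmodular (Qset Ω) s p u l := by
  have hQ : MeasurableSet (Qset Ω) :=
    MeasurableSet.univ.diff (hΩo.measurableSet.compl.prod hΩo.measurableSet.compl)
  unfold gmodular
  rw [Measure.restrict_univ, ← lintegral_indicator hQ]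
  refine lintegral_congr_ae ?_
  have h1 : ∀ᵐ z : RN N × RN N, z.1 ∉ Ω → u z.1 = 0 :=
    Measure.quasiMeasurePreserving_fst.ae hu
  have h2 : ∀ᵐ z : RN N × RN N, z.2 ∉ Ω → u z.2 = 0 :=
    Measure.quasiMeasurePreserving_snd.ae hu
  filter_upwards [h1, h2] with z hz1 hz2
  by_cases hz : z ∈ Qset Ω
  · rw [indicator_of_mem hz]
  · have hz' : z.1 ∉ Ω ∧ z.2 ∉ Ω := by simpa [Qset] using hz
    have hp0 : 0 < p z.1 z.2 := by linarith [h.one_lt, h.exponent_ge z.1 z.2]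
    rw [indicator_of_notMem hz, hz1 hz'.1, hz2 hz'.2, sub_zero, abs_zero, zero_div,
      ENNReal.ofReal_zero, ENNReal.zero_rpow_of_pos hp0, ENNReal.zero_div]

theorem ofReal_div_rpow_le {a k e : ℝ} (ha : 0 ≤ a) (hk : 1 ≤ k) (he : 1 ≤ e) :
    ENNReal.ofReal (a / k) ^ e ≤ ENNReal.ofReal (1 / k) * ENNReal.ofReal a ^ e := by
  have hk0 : 0 < k := by linarith
  rw [ENNReal.ofReal_rpow_of_nonneg (by positivity) (by linarith),
    ENNReal.ofReal_rpow_of_nonneg ha (by linarith), ← ENNReal.ofReal_mul (by positivity)]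
  refine ENNReal.ofReal_le_ofReal ?_
  rw [div_eq_mul_one_div, Real.mul_rpow ha (by positivity), mul_comm]
  have h1 : (1 / k) ^ e ≤ (1 / k) ^ (1 : ℝ) :=
    Real.rpow_le_rpow_of_exponent_ge (by positivity) ((div_le_one hk0).2 hk) he
  rw [Real.rpow_one] at h1
  gcongr

theorem gmodular_mul_le_s7 (h : UniformExponents s p σ q₀ P c) {u : RN N → ℝ} {l k : ℝ}
    (hl : 0 < l) (hk : 1 ≤ k) :
    gmodular univ s p u (l * k) ≤ ENNReal.ofReal (1 / k) * gmodular univ s p u l := by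
  unfold gmodular
  rw [← lintegral_const_mul' _ _ ENNReal.ofReal_ne_top]
  refine lintegral_mono fun z => ?_
  rw [← mul_div_assoc, ← div_div]
  refine ENNReal.div_le_div_right ?_ _
  exact ofReal_div_rpow_le (by positivity) hk (h.one_lt.le.trans (h.exponent_ge _ _))

theorem MemX0.nonempty_scales {β u : RN N → ℝ} (hΩo : IsOpen Ω)
    (h : UniformExponents s p σ q₀ P c) (hu : MemX0 Ω s p β u) :
    {l | 0 < l ∧ gmodular univ s p u l < 1}.Nonempty := by
  obtain ⟨-, -, ⟨l, hl, hlt⟩, hz⟩ := hu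
  rw [← gmodular_univ_eq_Qset hΩo h hz] at hlt
  set g := (gmodular univ s p u l).toReal with hg
  have hg0 : 0 ≤ g := ENNReal.toReal_nonneg
  refine ⟨l * (g + 1), by positivity, (gmodular_mul_le_s7 h hl (by linarith)).trans_lt ?_⟩
  rw [← ENNReal.ofReal_toReal hlt.ne, ← hg, ← ENNReal.ofReal_mul (by positivity),
    ENNReal.ofReal_lt_one, one_div, inv_mul_lt_iff₀ (by linarith)]
  linarith

theorem MemX0.admissible_div {β u : RN N → ℝ} (hu : MemX0 Ω s p β u) {l : ℝ} (hl : 0 < l)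
    (hlt : gmodular univ s p u l < 1) : Admissible Ω s p (fun x => u x / l) where
  measurable := hu.1.div_const l
  ae_eq_zero := by
    filter_upwards [hu.2.2.2] with x hx hxΩ
    rw [hx hxΩ, zero_div]
  gmodular_le := by
    rw [← gmodular_eq_gmodular_div hl]
    exact hlt.le

theorem MemX0.admissible_div_of_x0Norm_lt {β u : RN N → ℝ} (hΩo : IsOpen Ω)
    (h : UniformExponents s p σ q₀ P c) (hu : MemX0 Ω s p β u) {L : ℝ}
    (hL : x0Norm s p u < L) : Admissible Ω s p (fun x => u x / L) := by
  obtain ⟨l, ⟨hl, hlt⟩, hlL⟩ := exists_lt_of_csInf_lt (hu.nonempty_scales hΩo h) hL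
  have hL0 : 0 < L := hl.trans hlL
  refine hu.admissible_div hL0 (lt_of_le_of_lt ?_ hlt)
  unfold gmodular
  refine lintegral_mono fun z => ENNReal.div_le_div_right ?_ _
  have : 0 ≤ p z.1 z.2 := by linarith [h.one_lt, h.exponent_ge z.1 z.2]
  gcongr

theorem ofReal_rpow_le_one_add {a g m : ℝ} (ha : 0 ≤ a) (hg : 0 ≤ g) (hgm : g ≤ m) :
    ENNReal.ofReal a ^ g ≤ 1 + ENNReal.ofReal a ^ m := by
  rw [ENNReal.ofReal_rpow_of_nonneg ha hg, ENNReal.ofReal_rpow_of_nonneg ha (hg.trans hgm),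
    ← ENNReal.ofReal_one, ← ENNReal.ofReal_add zero_le_one (by positivity)]
  exact ENNReal.ofReal_le_ofReal (rpow_le_one_add_rpow ha hg hgm)

theorem luxNorm_le {γ u : RN N → ℝ} {l : ℝ} (hl : 0 < l) (h : lmodular Ω γ u l ≤ 1) :
    luxNorm Ω γ u ≤ l :=
  csInf_le ⟨0, fun _ hx => hx.1.le⟩ ⟨hl, h⟩

theorem luxNorm_nonneg (γ u : RN N → ℝ) : 0 ≤ luxNorm Ω γ u :=
  Real.sInf_nonneg fun _ hx => hx.1.le

/-- The continuous embedding of `X₀` into a variable exponent Lebesgue space. -/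
theorem exists_luxNorm_le_mul_x0Norm (hΩo : IsOpen Ω) (hΩb : Bornology.IsBounded Ω)
    (h : UniformExponents s p σ q₀ P c) {γ m : RN N → ℝ} {C : ℝ≥0∞} (hC : C ≠ ⊤)
    (hγ : ∀ x ∈ Ω, 1 ≤ γ x) (hγm : ∀ x ∈ Ω, γ x ≤ m x)
    (hm : ∀ u, Admissible Ω s p u → ∫⁻ x in Ω, ENNReal.ofReal |u x| ^ m x ≤ C)
    (β : RN N → ℝ) :
    ∃ K : ℝ, 0 < K ∧ ∀ u, MemX0 Ω s p β u → luxNorm Ω γ u ≤ K * x0Norm s p u := by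
  have hA : volume Ω + C ≠ ⊤ := ENNReal.add_ne_top.2 ⟨hΩb.measure_lt_top.ne, hC⟩
  set A := (volume Ω + C).toReal with hA'
  have hA0 : 0 ≤ A := ENNReal.toReal_nonneg
  refine ⟨A + 1, by linarith, fun u hu => ?_⟩
  rw [← div_le_iff₀' (by linarith)]
  refine le_csInf (hu.nonempty_scales hΩo h) fun l hl => ?_
  rw [div_le_iff₀' (by linarith)]
  refine luxNorm_le (mul_pos (by linarith) hl.1) ?_
  have hadm := hm _ (hu.admissible_div hl.1 hl.2)
  calc lmodular Ω γ u ((A + 1) * l)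
      ≤ ∫⁻ x in Ω, ENNReal.ofReal (1 / (A + 1)) *
          (1 + ENNReal.ofReal |u x / l| ^ m x) := by
        refine setLIntegral_mono' hΩo.measurableSet fun x hx => ?_
        have e : |u x| / ((A + 1) * l) = |u x / l| / (A + 1) := by
          rw [abs_div, abs_of_pos hl.1, div_div, mul_comm]
        rw [e]
        refine (ofReal_div_rpow_le (abs_nonneg _) (by linarith) (hγ x hx)).trans ?_
        gcongr
        exact ofReal_rpow_le_one_add (abs_nonneg _) (by linarith [hγ x hx]) (hγm x hx)
    _ ≤ ENNReal.ofReal (1 / (A + 1)) * (volume Ω + C) := by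
        rw [lintegral_const_mul' _ _ ENNReal.ofReal_ne_top,
          lintegral_add_left measurable_const, setLIntegral_const, one_mul]
        gcongr
    _ ≤ 1 := by
        rw [← ENNReal.ofReal_toReal hA, ← hA', ← ENNReal.ofReal_mul (by positivity),
          ENNReal.ofReal_le_one, one_div, inv_mul_le_iff₀ (by linarith)]
        linarith

/-- The average of `w` over the ball of radius `δ` around `a`. -/
def ballAverage (w : RN N → ℝ) (a : RN N) (δ : ℝ) : ℝ :=
  (unitBallVolume N * δ ^ (N : ℝ))⁻¹ * ∫ y in Metric.ball a δ, w y

theorem volume_real_ball (a : RN N) {δ : ℝ} (hδ : 0 < δ) :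
    volume.real (Metric.ball a δ) = unitBallVolume N * δ ^ (N : ℝ) := by
  have := unitBallVolume_pos (N := N)
  rw [Measure.real, volume_ball_eq_ofReal a hδ, ENNReal.toReal_ofReal (by positivity)]

theorem ofReal_abs_ballAverage_le {w : RN N → ℝ} (a : RN N) {δ : ℝ} (hδ : 0 < δ) :
    ENNReal.ofReal |ballAverage w a δ| ≤
      ENNReal.ofReal (unitBallVolume N * δ ^ (N : ℝ))⁻¹ *
        ∫⁻ y in Metric.ball a δ, ENNReal.ofReal |w y| := by
  have hω := unitBallVolume_pos (N := N)
  have hv : 0 < unitBallVolume N * δ ^ (N : ℝ) := by positivity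
  rw [ballAverage, abs_mul, abs_of_pos (inv_pos.2 hv), ENNReal.ofReal_mul (inv_pos.2 hv).le]
  gcongr
  have := enorm_integral_le_lintegral_enorm (μ := volume.restrict (Metric.ball a δ)) w
  simpa only [Real.enorm_eq_ofReal_abs] using this

theorem ofReal_abs_sub_ballAverage_le (h : UniformExponents s p σ q₀ P c) {w : RN N → ℝ}
    (hw : Integrable w) {x a : RN N} {δ : ℝ} (hδ : 0 < δ) (hδ' : 2 * δ ≤ 1)
    (hx : x ∈ Metric.ball a δ) :
    ENNReal.ofReal |w x - ballAverage w a δ| ≤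
      ENNReal.ofReal ((2 * δ) ^ σ * (1 + 2 ^ (N : ℝ) / unitBallVolume N)) *
        (1 + gdensity s p w x) := by
  have hω := unitBallVolume_pos (N := N)
  have hv : 0 < unitBallVolume N * δ ^ (N : ℝ) := by positivity
  have e1 : w x - ballAverage w a δ = ballAverage (fun y => w x - w y) a δ := by
    have : ∫ y in Metric.ball a δ, (w x - w y) =
        unitBallVolume N * δ ^ (N : ℝ) * w x - ∫ y in Metric.ball a δ, w y := by
      have hc : IntegrableOn (fun _ => w x) (Metric.ball a δ) :=
        integrableOn_const measure_ball_lt_top.ne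
      rw [integral_sub hc hw.integrableOn, setIntegral_const, smul_eq_mul, volume_real_ball a hδ]
    rw [ballAverage, ballAverage, this, mul_sub, inv_mul_cancel_left₀ hv.ne']
  have hdist : ∀ y ∈ Metric.ball a δ, dist x y ≤ 2 * δ := by
    intro y hy
    have h1 := dist_triangle x a y
    have h2 : dist x a < δ := hx
    have h3 : dist y a < δ := hy
    rw [dist_comm] at h3
    linarith
  have e2 := setLIntegral_abs_sub_le (s := s) (p := p) (u := w) (x := x) (B := Metric.ball a δ)
    (r := 2 * δ) (t := σ) (q := 1) (l := 1) Metric.isOpen_ball.measurableSet (by positivity) hδ'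
    h.pos_order.le le_rfl le_rfl (fun y hy => ⟨hdist y hy, h.order_ge x y,
      h.one_lt.le.trans (h.exponent_ge x y)⟩)
  rw [e1]
  refine (ofReal_abs_ballAverage_le a hδ).trans ((mul_le_mul' le_rfl e2).trans ?_)
  rw [volume_ball_eq_ofReal a hδ, sub_self, Real.rpow_zero, mul_one, mul_add,
    ← mul_assoc (ENNReal.ofReal _), ← mul_assoc (ENNReal.ofReal _),
    ← ENNReal.ofReal_mul (by positivity), ← ENNReal.ofReal_mul (by positivity),
    ← ENNReal.ofReal_mul (by positivity), mul_add, mul_one]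
  have k1 : (unitBallVolume N * δ ^ (N : ℝ))⁻¹ * (2 * δ) ^ σ * (unitBallVolume N * δ ^ (N : ℝ))
      = (2 * δ) ^ σ := by
    field_simp
  have k2 : (unitBallVolume N * δ ^ (N : ℝ))⁻¹ * ((2 * δ) ^ σ * (2 * δ) ^ (N : ℝ))
      = (2 * δ) ^ σ * (2 ^ (N : ℝ) / unitBallVolume N) := by
    rw [Real.mul_rpow (y := δ) (z := (N : ℝ)) (by norm_num) hδ.le]
    field_simp
  rw [k1, k2]
  have k3 : 0 ≤ 2 ^ (N : ℝ) / unitBallVolume N := by positivity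
  have k4 : 0 < (2 * δ) ^ σ := by positivity
  gcongr
  · nlinarith
  · nlinarith

theorem Admissible.integrable (hN : 2 ≤ N) (hΩo : IsOpen Ω) (hΩb : Bornology.IsBounded Ω)
    (h : UniformExponents s p σ q₀ P c) {w : RN N → ℝ} (hw : Admissible Ω s p w) :
    Integrable w := by
  obtain ⟨C, hC, hC'⟩ := exists_lintegral_abs_le hN hΩo hΩb h
  have h1 : IntegrableOn w Ω := by
    refine ⟨hw.measurable.aestronglyMeasurable, ?_⟩
    rw [hasFiniteIntegral_iff_enorm]
    simp only [Real.enorm_eq_ofReal_abs]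
    exact (hC' w hw).trans_lt hC.lt_top
  exact h1.integrable_of_ae_notMem_eq_zero hw.ae_eq_zero

/-- Finitely many averages determine an admissible function up to a small `L¹` error. -/
theorem exists_finite_discretization (hN : 2 ≤ N) (hΩo : IsOpen Ω)
    (hΩb : Bornology.IsBounded Ω) (h : UniformExponents s p σ q₀ P c) {ε : ℝ} (hε : 0 < ε) :
    ∃ (ι : Type) (_ : Fintype ι) (F : {w // Admissible Ω s p w} → ι), ∀ w w',
      F w = F w' → ∫⁻ x in Ω, ENNReal.ofReal |w.1 x - w'.1 x| ≤ ENNReal.ofReal ε := by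
  have hω := unitBallVolume_pos (N := N)
  obtain ⟨C, hC, hC'⟩ := exists_lintegral_abs_le hN hΩo hΩb h
  set V := (volume Ω).toReal with hV
  have hV0 : 0 ≤ V := ENNReal.toReal_nonneg
  have hVΩ : volume Ω = ENNReal.ofReal V := (ENNReal.ofReal_toReal hΩb.measure_lt_top.ne).symm
  set B := 1 + 2 ^ (N : ℝ) / unitBallVolume N with hB
  have hB0 : 0 < B := by positivity
  obtain ⟨δ, hδ, hδ', hδε⟩ : ∃ δ : ℝ, 0 < δ ∧ 2 * δ ≤ 1 ∧
      (2 * δ) ^ σ * B * (2 * (V + 1)) ≤ ε / 2 := by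
    set a := ε / 2 / (B * (2 * (V + 1))) with ha
    have ha0 : 0 < a := by positivity
    refine ⟨min 1 (a ^ (1 / σ)) / 2, by positivity, ?_, ?_⟩
    · linarith [min_le_left 1 (a ^ (1 / σ))]
    · have h1 : (2 * (min 1 (a ^ (1 / σ)) / 2)) ^ σ ≤ a := by
        rw [mul_div_cancel₀ _ two_ne_zero]
        calc (min 1 (a ^ (1 / σ))) ^ σ ≤ (a ^ (1 / σ)) ^ σ :=
              Real.rpow_le_rpow (by positivity) (min_le_right _ _) h.pos_order.le
          _ = a := by
              rw [← Real.rpow_mul ha0.le, one_div_mul_cancel h.pos_order.ne', Real.rpow_one]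
      rw [mul_assoc]
      calc _ ≤ a * (B * (2 * (V + 1))) := by gcongr
        _ = ε / 2 := by rw [ha]; field_simp
  obtain ⟨η, hη, hηε⟩ : ∃ η : ℝ, 0 < η ∧ η * V ≤ ε / 2 := by
    refine ⟨ε / 2 / (V + 1), by positivity, ?_⟩
    rw [div_mul_eq_mul_div, div_le_iff₀ (by linarith)]
    nlinarith
  obtain ⟨t, ht, hcover⟩ := Metric.totallyBounded_iff.1
    (hΩb.isCompact_closure.totallyBounded.subset subset_closure) δ hδ
  set A := (unitBallVolume N * δ ^ (N : ℝ))⁻¹ * C.toReal with hA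
  have hbound : ∀ w, Admissible Ω s p w → ∀ a, |ballAverage w a δ| ≤ A := by
    intro w hw a
    have h1 := ofReal_abs_ballAverage_le (w := w) a hδ
    have h2 : ∫⁻ y in Metric.ball a δ, ENNReal.ofReal |w y| ≤ C := by
      refine le_trans (le_trans (setLIntegral_le_lintegral _ _) (le_of_eq ?_)) (hC' w hw)
      rw [← lintegral_indicator hΩo.measurableSet]
      refine lintegral_congr_ae ?_
      filter_upwards [hw.ae_eq_zero] with y hy
      by_cases hyΩ : y ∈ Ω
      · rw [indicator_of_mem hyΩ]
      · rw [indicator_of_notMem hyΩ, hy hyΩ, abs_zero, ENNReal.ofReal_zero]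
    have h3 := h1.trans (mul_le_mul' le_rfl h2)
    rw [← ENNReal.ofReal_toReal hC, ← ENNReal.ofReal_mul (by positivity),
      ENNReal.ofReal_le_ofReal_iff (by positivity)] at h3
    exact h3
  have hA0 : 0 ≤ A := by positivity
  have := ht.to_subtype
  have := Fintype.ofFinite t
  classical
  have hmem : ∀ (w : {w // Admissible Ω s p w}) (a : RN N),
      ⌊ballAverage w.1 a δ / η⌋ ∈ Set.Icc ⌊-A / η⌋ ⌊A / η⌋ := by
    intro w a
    have h1 := abs_le.1 (hbound w.1 w.2 a)
    exact ⟨Int.floor_le_floor (by gcongr; exact h1.1), Int.floor_le_floor (by gcongr; exact h1.2)⟩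
  refine ⟨Fin (Fintype.card (t → Set.Icc ⌊-A / η⌋ ⌊A / η⌋)), inferInstance,
    fun w => Fintype.equivFin _ fun a => ⟨⌊ballAverage w.1 a δ / η⌋, hmem w a⟩,
    fun w w' hww => ?_⟩
  have hww' := (Fintype.equivFin _).injective hww
  have hint := w.2.integrable hN hΩo hΩb h
  have hint' := w'.2.integrable hN hΩo hΩb h
  have hpt : ∀ x ∈ Ω, ENNReal.ofReal |w.1 x - w'.1 x| ≤ ENNReal.ofReal η +
      ENNReal.ofReal ((2 * δ) ^ σ * B) *
        ((1 + gdensity s p w.1 x) + (1 + gdensity s p w'.1 x)) := by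
    intro x hx
    obtain ⟨a, hat, hxa⟩ := mem_iUnion₂.1 (hcover hx)
    have e1 := ofReal_abs_sub_ballAverage_le h hint hδ hδ' hxa
    have e2 := ofReal_abs_sub_ballAverage_le h hint' hδ hδ' hxa
    have e3 : |ballAverage w.1 a δ - ballAverage w'.1 a δ| ≤ η := by
      have h1 : ⌊ballAverage w.1 a δ / η⌋ = ⌊ballAverage w'.1 a δ / η⌋ :=
        congrArg Subtype.val (congrFun hww' ⟨a, hat⟩)
      have h2 := Int.abs_sub_lt_one_of_floor_eq_floor h1
      rw [← sub_div, abs_div, abs_of_pos hη, div_lt_one hη] at h2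
      exact h2.le
    have e4 : |w.1 x - w'.1 x| ≤ η +
        (|w.1 x - ballAverage w.1 a δ| + |w'.1 x - ballAverage w'.1 a δ|) := by
      have h1 := abs_add_le (w.1 x - ballAverage w.1 a δ)
        (ballAverage w.1 a δ - ballAverage w'.1 a δ)
      have h2 := abs_sub (w.1 x - ballAverage w'.1 a δ) (w'.1 x - ballAverage w'.1 a δ)
      rw [sub_add_sub_cancel] at h1
      rw [sub_sub_sub_cancel_right] at h2
      linarith
    calc ENNReal.ofReal |w.1 x - w'.1 x| ≤ _ := ENNReal.ofReal_le_ofReal e4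
      _ = ENNReal.ofReal η + (ENNReal.ofReal |w.1 x - ballAverage w.1 a δ| +
          ENNReal.ofReal |w'.1 x - ballAverage w'.1 a δ|) := by
          rw [ENNReal.ofReal_add hη.le (by positivity),
            ENNReal.ofReal_add (abs_nonneg _) (abs_nonneg _)]
      _ ≤ _ := by
          rw [mul_add]
          gcongr
  calc ∫⁻ x in Ω, ENNReal.ofReal |w.1 x - w'.1 x|
      ≤ ∫⁻ x in Ω, (ENNReal.ofReal η + ENNReal.ofReal ((2 * δ) ^ σ * B) *
        ((1 + gdensity s p w.1 x) + (1 + gdensity s p w'.1 x))) :=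
        setLIntegral_mono' hΩo.measurableSet hpt
    _ ≤ ENNReal.ofReal η * volume Ω + ENNReal.ofReal ((2 * δ) ^ σ * B) *
          ((volume Ω + 1) + (volume Ω + 1)) := by
        rw [lintegral_add_left measurable_const, setLIntegral_const,
          lintegral_const_mul' _ _ ENNReal.ofReal_ne_top,
          lintegral_add_left ((h.measurable_gdensity w.2.measurable).const_add 1)]
        gcongr
        · exact w.2.lintegral_one_add_gdensity_le h
        · exact w'.2.lintegral_one_add_gdensity_le h
    _ ≤ ENNReal.ofReal ε := by
        rw [hVΩ, ← ENNReal.ofReal_one, ← ENNReal.ofReal_add hV0 zero_le_one,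
          ← ENNReal.ofReal_add (by positivity) (by positivity),
          ← ENNReal.ofReal_mul (by positivity), ← ENNReal.ofReal_mul (by positivity),
          ← ENNReal.ofReal_add (by positivity) (by positivity)]
        refine ENNReal.ofReal_le_ofReal ?_
        linarith

/-- Sequences of admissible functions are precompact in `L¹(Ω)`. -/
theorem exists_subseq_tendsto_lintegral (hN : 2 ≤ N) (hΩo : IsOpen Ω)
    (hΩb : Bornology.IsBounded Ω) (h : UniformExponents s p σ q₀ P c) {w : ℕ → RN N → ℝ}
    (hw : ∀ k, Admissible Ω s p (w k)) :
    ∃ φ : ℕ → ℕ, StrictMono φ ∧ ∃ v : RN N → ℝ, Measurable v ∧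
      Tendsto (fun k => ∫⁻ x in Ω, ENNReal.ofReal |w (φ k) x - v x|) atTop (nhds 0) ∧
      ∀ᵐ x ∂(volume.restrict Ω), Tendsto (fun k => w (φ k) x) atTop (nhds (v x)) := by
  have hmem : ∀ k, MemLp (w k) 1 (volume.restrict Ω) := fun k =>
    memLp_one_iff_integrable.2 ((hw k).integrable hN hΩo hΩb h).integrableOn
  set f : ℕ → Lp ℝ 1 (volume.restrict Ω) := fun k => (hmem k).toLp (w k) with hf
  have hedist : ∀ i j, edist (f i) (f j) = ∫⁻ x in Ω, ENNReal.ofReal |w i x - w j x| := by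
    intro i j
    rw [hf, Lp.edist_toLp_toLp, eLpNorm_one_eq_lintegral_enorm]
    simp only [Pi.sub_apply, Real.enorm_eq_ofReal_abs]
  have htb : TotallyBounded (Set.range f) := by
    refine Metric.totallyBounded_of_finite_discretization fun ε hε => ?_
    obtain ⟨ι, hι, F, hF⟩ := exists_finite_discretization hN hΩo hΩb h (half_pos hε)
    refine ⟨ι, hι, fun y => F ⟨w y.2.choose, hw _⟩, fun y y' hyy => ?_⟩
    have h1 := hF _ _ hyy
    rw [← hedist, y.2.choose_spec, y'.2.choose_spec, edist_dist,
      ENNReal.ofReal_le_ofReal_iff (half_pos hε).le] at h1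
    linarith
  have hcomp : IsCompact (closure (Set.range f)) :=
    htb.closure.isCompact_of_isClosed isClosed_closure
  obtain ⟨g, -, φ, hφ, hlim⟩ := hcomp.tendsto_subseq fun k => subset_closure ⟨k, rfl⟩
  obtain ⟨ψ, hψ, hae⟩ := (tendstoInMeasure_of_tendsto_Lp hlim).exists_seq_tendsto_ae
  refine ⟨φ ∘ ψ, hφ.comp hψ, g, (Lp.stronglyMeasurable g).measurable, ?_, ?_⟩
  · have h1 := (tendsto_iff_edist_tendsto_0.1 hlim).comp hψ.tendsto_atTop
    refine h1.congr fun k => ?_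
    simp only [Function.comp_apply]
    rw [Lp.edist_def, eLpNorm_one_eq_lintegral_enorm]
    refine lintegral_congr_ae ?_
    filter_upwards [(hmem (φ (ψ k))).coeFn_toLp] with x hx
    rw [Pi.sub_apply, hx, Real.enorm_eq_ofReal_abs]
  · have h2 : ∀ᵐ x ∂(volume.restrict Ω), ∀ k, f k x = w k x :=
      ae_all_iff.2 fun k => (hmem k).coeFn_toLp
    filter_upwards [hae, h2] with x hx hx2
    simpa only [Function.comp_apply, hx2] using hx

theorem mul_abs_sub_rpow_le {Λ a b m M : ℝ} (hΛ : 0 < Λ) (hm : 1 ≤ m) (hmM : m ≤ M) :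
    (Λ * |a - b|) ^ m ≤ max 1 (2 * Λ) ^ M * (|a| ^ m + |b| ^ m) := by
  set T := max |a| |b| with hT
  have hT0 : 0 ≤ T := (abs_nonneg a).trans (le_max_left _ _)
  have h1 : Λ * |a - b| ≤ max 1 (2 * Λ) * T := by
    have e1 : |a - b| ≤ 2 * T := by
      have := abs_sub a b
      have h2 := le_max_left |a| |b|
      have h3 := le_max_right |a| |b|
      linarith
    calc Λ * |a - b| ≤ Λ * (2 * T) := by gcongr
      _ = 2 * Λ * T := by ring
      _ ≤ _ := by gcongr; exact le_max_right _ _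
  have h2 : T ^ m ≤ |a| ^ m + |b| ^ m := by
    have e1 : 0 ≤ |a| ^ m := by positivity
    have e2 : 0 ≤ |b| ^ m := by positivity
    rcases max_choice |a| |b| with e | e <;> rw [hT, e] <;> linarith
  calc (Λ * |a - b|) ^ m ≤ (max 1 (2 * Λ) * T) ^ m :=
        Real.rpow_le_rpow (by positivity) h1 (by linarith)
    _ = max 1 (2 * Λ) ^ m * T ^ m := Real.mul_rpow (by positivity) hT0
    _ ≤ max 1 (2 * Λ) ^ M * (|a| ^ m + |b| ^ m) := by
        gcongr
        exact le_max_left _ _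

theorem lintegral_rpow_le_of_ae_tendsto {w : ℕ → RN N → ℝ} {v m : RN N → ℝ} {C : ℝ≥0∞}
    (hw : ∀ k, Measurable (w k)) (hm : Measurable m)
    (hC : ∀ k, ∫⁻ x in Ω, ENNReal.ofReal |w k x| ^ m x ≤ C)
    (hlim : ∀ᵐ x ∂(volume.restrict Ω), Tendsto (fun k => w k x) atTop (nhds (v x))) :
    ∫⁻ x in Ω, ENNReal.ofReal |v x| ^ m x ≤ C := by
  calc ∫⁻ x in Ω, ENNReal.ofReal |v x| ^ m x
      = ∫⁻ x in Ω, liminf (fun k => ENNReal.ofReal |w k x| ^ m x) atTop := by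
        refine lintegral_congr_ae ?_
        filter_upwards [hlim] with x hx
        exact (((ENNReal.continuous_rpow_const.tendsto _).comp
          ((ENNReal.continuous_ofReal.tendsto _).comp hx.abs)).liminf_eq).symm
    _ ≤ liminf (fun k => ∫⁻ x in Ω, ENNReal.ofReal |w k x| ^ m x) atTop :=
        lintegral_liminf_le fun k => (ENNReal.measurable_ofReal.comp
          (measurable_norm.comp (hw k))).pow hm
    _ ≤ C := liminf_le_of_le (by isBoundedDefault) fun b hb => by
        obtain ⟨k, hk⟩ := hb.exists
        exact hk.trans (hC k)

/-- Interpolation between `L¹` convergence and a uniform bound with a larger exponent. -/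
theorem eventually_lintegral_mul_abs_sub_rpow_le_one (hΩ : MeasurableSet Ω)
    {w : ℕ → RN N → ℝ} {v m γ : RN N → ℝ} {C : ℝ≥0∞} {M ε Λ : ℝ}
    (hw : ∀ k, Measurable (w k)) (hv : Measurable v) (hm : Measurable m) (hm1 : ∀ x, 1 ≤ m x)
    (hmM : ∀ x, m x ≤ M) (hε : 0 < ε) (hγ : ∀ x ∈ Ω, 1 ≤ γ x)
    (hγm : ∀ x ∈ Ω, γ x + ε ≤ m x) (hCtop : C ≠ ⊤)
    (hC : ∀ k, ∫⁻ x in Ω, ENNReal.ofReal |w k x| ^ m x ≤ C)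
    (hCv : ∫⁻ x in Ω, ENNReal.ofReal |v x| ^ m x ≤ C)
    (hlim : Tendsto (fun k => ∫⁻ x in Ω, ENNReal.ofReal |w k x - v x|) atTop (nhds 0))
    (hΛ : 0 < Λ) :
    ∀ᶠ k in atTop, ∫⁻ x in Ω, ENNReal.ofReal (Λ * |w k x - v x|) ^ γ x ≤ 1 := by
  set D := max 1 (2 * Λ) ^ M with hD
  have hD0 : 0 ≤ D := by positivity
  set S := D * (C.toReal + C.toReal) with hS
  have hS0 : 0 ≤ S := by positivity
  have hτ : 0 < 1 / (2 * (S + 1)) := by positivity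
  obtain ⟨K, hK, hK'⟩ := exists_rpow_le_add (M := M) hε hτ
  have hlim' : ∀ᶠ k in atTop, ∫⁻ x in Ω, ENNReal.ofReal |w k x - v x| <
      ENNReal.ofReal (1 / (2 * (K * Λ))) :=
    hlim.eventually (gt_mem_nhds (ENNReal.ofReal_pos.2 (by positivity)))
  have hmeas : ∀ {u : RN N → ℝ}, Measurable u →
      Measurable fun x => ENNReal.ofReal |u x| ^ m x := fun hu =>
    (ENNReal.measurable_ofReal.comp (measurable_norm.comp hu)).pow hm
  filter_upwards [hlim'] with k hk
  have hpt : ∀ x ∈ Ω, ENNReal.ofReal (Λ * |w k x - v x|) ^ γ x ≤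
      ENNReal.ofReal (1 / (2 * (S + 1)) * D) *
        (ENNReal.ofReal |w k x| ^ m x + ENNReal.ofReal |v x| ^ m x) +
      ENNReal.ofReal (K * Λ) * ENNReal.ofReal |w k x - v x| := by
    intro x hx
    have hm0 : 0 ≤ m x := zero_le_one.trans (hm1 x)
    have e0 : 0 ≤ Λ * |w k x - v x| := by positivity
    have e1 := hK' _ _ (m x) e0 (hγ x hx)
      (by linarith [hγm x hx, hmM x]) (hγm x hx)
    have e2 := mul_abs_sub_rpow_le (a := w k x) (b := v x) hΛ (hm1 x) (hmM x)
    have e3 : (Λ * |w k x - v x|) ^ γ x ≤ 1 / (2 * (S + 1)) * D *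
        (|w k x| ^ m x + |v x| ^ m x) + K * Λ * |w k x - v x| := by
      calc _ ≤ _ := e1
        _ ≤ 1 / (2 * (S + 1)) * (D * (|w k x| ^ m x + |v x| ^ m x)) +
            K * (Λ * |w k x - v x|) := by gcongr
        _ = _ := by ring
    rw [ENNReal.ofReal_rpow_of_nonneg e0 (by linarith [hγ x hx]),
      ENNReal.ofReal_rpow_of_nonneg (abs_nonneg _) hm0,
      ENNReal.ofReal_rpow_of_nonneg (abs_nonneg _) hm0,
      ← ENNReal.ofReal_add (by positivity) (by positivity),
      ← ENNReal.ofReal_mul (by positivity), ← ENNReal.ofReal_mul (by positivity),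
      ← ENNReal.ofReal_add (by positivity) (by positivity)]
    exact ENNReal.ofReal_le_ofReal e3
  calc ∫⁻ x in Ω, ENNReal.ofReal (Λ * |w k x - v x|) ^ γ x
      ≤ _ := setLIntegral_mono' hΩ hpt
    _ = ENNReal.ofReal (1 / (2 * (S + 1)) * D) *
        ((∫⁻ x in Ω, ENNReal.ofReal |w k x| ^ m x) + ∫⁻ x in Ω, ENNReal.ofReal |v x| ^ m x) +
        ENNReal.ofReal (K * Λ) * ∫⁻ x in Ω, ENNReal.ofReal |w k x - v x| := by
        have hsum : Measurable fun x =>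
            ENNReal.ofReal |w k x| ^ m x + ENNReal.ofReal |v x| ^ m x :=
          (hmeas (hw k)).add (hmeas hv)
        rw [lintegral_add_left (hsum.const_mul _),
          lintegral_const_mul' _ _ ENNReal.ofReal_ne_top,
          lintegral_const_mul' _ _ ENNReal.ofReal_ne_top, lintegral_add_left (hmeas (hw k))]
    _ ≤ ENNReal.ofReal (1 / (2 * (S + 1)) * D) * (C + C) +
        ENNReal.ofReal (K * Λ) * ENNReal.ofReal (1 / (2 * (K * Λ))) := by
        gcongr
        exact hC k
    _ ≤ 1 := by
        rw [← ENNReal.ofReal_toReal hCtop,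
          ← ENNReal.ofReal_add ENNReal.toReal_nonneg ENNReal.toReal_nonneg,
          ← ENNReal.ofReal_mul (by positivity), ← ENNReal.ofReal_mul (by positivity),
          ← ENNReal.ofReal_add (by positivity) (by positivity), ← ENNReal.ofReal_one]
        refine ENNReal.ofReal_le_ofReal ?_
        have e1 : 1 / (2 * (S + 1)) * D * (C.toReal + C.toReal) ≤ 1 / 2 := by
          rw [mul_assoc, ← hS, div_mul_eq_mul_div, div_le_div_iff₀ (by positivity) (by norm_num)]
          linarith
        have e2 : K * Λ * (1 / (2 * (K * Λ))) = 1 / 2 := by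
          field_simp
        linarith

/-- A sequence bounded in `X₀` has a subsequence converging in `L^{γ(x)}(Ω)`. -/
theorem exists_subseq_tendsto_luxNorm (hN : 2 ≤ N) (hΩo : IsOpen Ω)
    (hΩb : Bornology.IsBounded Ω) (h : UniformExponents s p σ q₀ P c) {m β γ : RN N → ℝ}
    {C : ℝ≥0∞} {M ε : ℝ} (hm : Measurable m) (hm1 : ∀ x, 1 ≤ m x) (hmM : ∀ x, m x ≤ M)
    (hε : 0 < ε) (hγ : ∀ x ∈ Ω, 1 ≤ γ x) (hγm : ∀ x ∈ Ω, γ x + ε ≤ m x) (hCtop : C ≠ ⊤)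
    (hC : ∀ u, Admissible Ω s p u → ∫⁻ x in Ω, ENNReal.ofReal |u x| ^ m x ≤ C)
    {u : ℕ → RN N → ℝ} (hu : ∀ k, MemX0 Ω s p β (u k)) {R : ℝ}
    (hR : ∀ k, x0Norm s p (u k) ≤ R) :
    ∃ φ : ℕ → ℕ, StrictMono φ ∧ ∃ v : RN N → ℝ, MemVarLp Ω γ v ∧
      Tendsto (fun k => luxNorm Ω γ (fun x => u (φ k) x - v x)) atTop (nhds 0) := by
  set L := max R 0 + 1 with hL
  have hL0 : 0 < L := by positivity
  have hw : ∀ k, Admissible Ω s p (fun x => u k x / L) := fun k =>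
    (hu k).admissible_div_of_x0Norm_lt hΩo h
      (((hR k).trans (le_max_left _ _)).trans_lt (lt_add_one _))
  obtain ⟨φ, hφ, v, hv, hlim, hae⟩ := exists_subseq_tendsto_lintegral hN hΩo hΩb h hw
  have hCv : ∫⁻ x in Ω, ENNReal.ofReal |v x| ^ m x ≤ C :=
    lintegral_rpow_le_of_ae_tendsto (fun k => (hw (φ k)).measurable) hm
      (fun k => hC _ (hw (φ k))) hae
  refine ⟨φ, hφ, fun x => L * v x, ⟨hv.const_mul L, L, hL0, ?_⟩, ?_⟩
  · calc lmodular Ω γ (fun x => L * v x) L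
        ≤ ∫⁻ x in Ω, (1 + ENNReal.ofReal |v x| ^ m x) := by
          refine setLIntegral_mono' hΩo.measurableSet fun x hx => ?_
          rw [abs_mul, abs_of_pos hL0, mul_div_cancel_left₀ _ hL0.ne']
          exact ofReal_rpow_le_one_add (abs_nonneg _) (by linarith [hγ x hx])
            (by linarith [hγm x hx])
      _ ≤ volume Ω + C := by
          rw [lintegral_add_left measurable_const, setLIntegral_const, one_mul]
          gcongr
      _ < ⊤ := ENNReal.add_lt_top.2 ⟨hΩb.measure_lt_top, hCtop.lt_top⟩
  · rw [Metric.tendsto_atTop']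
    intro r hr
    have hev := eventually_lintegral_mul_abs_sub_rpow_le_one (Λ := L / (r / 2))
      hΩo.measurableSet (fun k => (hw (φ k)).measurable) hv hm hm1 hmM hε hγ hγm hCtop
      (fun k => hC _ (hw (φ k))) hCv hlim (by positivity)
    obtain ⟨n, hn⟩ := eventually_atTop.1 hev
    refine ⟨n, fun k hk => ?_⟩
    rw [Real.dist_eq, sub_zero, abs_of_nonneg (luxNorm_nonneg _ _)]
    refine (luxNorm_le (half_pos hr) (le_trans (le_of_eq ?_) (hn k hk.le))).trans_lt
      (half_lt_self hr)
    refine lintegral_congr fun x => ?_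
    have : |u (φ k) x - L * v x| / (r / 2) = L / (r / 2) * |u (φ k) x / L - v x| := by
      rw [show u (φ k) x - L * v x = L * (u (φ k) x / L - v x) by field_simp, abs_mul,
        abs_of_pos hL0]
      ring
    rw [this]

end Estimates

/-- Compact embedding `X₀ ↪ L^{γ(x)}(Ω)` (Theorem prp 3.3). -/
theorem statement7 {N : ℕ} (hN : 2 ≤ N) (Ω : Set (RN N))
    (hΩo : IsOpen Ω) (hΩb : Bornology.IsBounded Ω) (hΩne : Ω.Nonempty)
    (s p : RN N → RN N → ℝ) (β γ : RN N → ℝ)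
    (hs : S1 s) (hp : P1 s p)
    (hβ : CPlusOn (closure Ω) β) (hβ1 : ∀ x ∈ closure Ω, p x x ≤ β x)
    (hβ2 : ∀ x ∈ closure Ω, β x < pstar s p x)
    (hγ : CPlusOn (closure Ω) γ) (hγ1 : ∀ x ∈ closure Ω, 1 < γ x)
    (hγ2 : ∀ x ∈ closure Ω, γ x < pstar s p x) :
    (∃ C : ℝ, 0 < C ∧ ∀ u : RN N → ℝ, MemX0 Ω s p β u →
      luxNorm Ω γ u ≤ C * x0Norm s p u) ∧
    (∀ u : ℕ → RN N → ℝ, (∀ m, MemX0 Ω s p β (u m)) →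
      (∃ C : ℝ, ∀ m, x0Norm s p (u m) ≤ C) →
      ∃ φ : ℕ → ℕ, StrictMono φ ∧ ∃ v : RN N → ℝ, MemVarLp Ω γ v ∧
        Tendsto (fun k => luxNorm Ω γ (fun x => u (φ k) x - v x))
          atTop (nhds 0)) := by
  obtain ⟨σ, q₀, P, c, h⟩ := exists_uniformExponents hs hp
  obtain ⟨m, ε, M, C, hm, hε, hCtop, hγm, hm1, hmM, hC⟩ :=
    exists_supercritical_bound hN hΩo hΩb h hγ.1 hγ2
  have hγ' : ∀ x ∈ Ω, 1 ≤ γ x := fun x hx => (hγ1 x (subset_closure hx)).le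
  refine ⟨exists_luxNorm_le_mul_x0Norm hΩo hΩb h hCtop hγ'
    (fun x hx => by linarith [hγm x hx]) hC β, fun u hu hR => ?_⟩
  obtain ⟨R, hR⟩ := hR
  exact exists_subseq_tendsto_luxNorm hN hΩo hΩb h hm hm1 hmM hε hγ' hγm hCtop hC hu hR

end VarOrderChoquard
end
end
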